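/- Let d ≥ 3. For the random walk on the lamplighter group ℤ^d ≀ ℤ whose increments are i.i.d. uniform on the 2(d+1) elements {s_1^{±1},…,s_d^{±1}, t^{±1}}, with trajectory g_n and almost surely well-defined final configuration Φ_∞(ω) : ℤ^d → ℤ (the pointwise limit of the lamp components of g_n), every bounded measurable function on the path space that is measurable with respect to the tail σ-algebra ∩_N σ(g_N, g_{N+1}, …) coincides almost everywhere with a measurable function of the final configuration Φ_∞(ω). -/

import Mathlib

/-- Lattice points of `ℤ^d`. -/
abbrev Pt (d : ℕ) : Type := Fin d → ℤ

/-- The `i`-th standard basis vector of `ℤ^d`. -/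
def latE (d : ℕ) (i : Fin d) : Pt d := fun j => if j = i then 1 else 0

/-- One step of a lattice path: the letter `(i, b)` moves by `eᵢ` if `b` and by `-eᵢ`
otherwise. -/
def stepFn (d : ℕ) (p : Pt d) (s : Fin d × Bool) : Pt d :=
  p + (if s.2 then latE d s.1 else -latE d s.1)

/-- Total displacement of a word (= endpoint of the associated lattice path started
at `0`). -/
def disp (d : ℕ) (w : List (Fin d × Bool)) : Pt d :=
  (w.map fun s => if s.2 then latE d s.1 else -latE d s.1).sum

/-- Finitely supported lamp configurations `⊕_{v ∈ ℤ^d} ℤ`. -/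
abbrev Cfg (d : ℕ) : Type := (Fin d → ℤ) →₀ ℤ

/-- Translation of `ℤ^d` on itself. -/
def ptShift (d : ℕ) (u : Pt d) : Pt d ≃ Pt d where
  toFun v := v + u
  invFun v := v - u
  left_inv v := by simp
  right_inv v := by simp

/-- The translation action of `u ∈ ℤ^d` on configurations: `(u · f)(v) = f(v - u)`. -/
noncomputable def cfgShift (d : ℕ) (u : Pt d) : Cfg d ≃+ Cfg d :=
  Finsupp.domCongr (ptShift d u)

lemma cfgShift_apply (d : ℕ) (u : Pt d) (f : Cfg d) (v : Pt d) :
    cfgShift d u f v = f (v - u) := rfl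

/-- The translation action of `ℤ^d` on (multiplicatively written) configurations. -/
noncomputable def lampAut (d : ℕ) :
    Multiplicative (Pt d) →* MulAut (Multiplicative (Cfg d)) where
  toFun u := AddEquiv.toMultiplicative (cfgShift d u.toAdd)
  map_one' := by
    refine MulEquiv.ext fun f => ?_
    show Multiplicative.ofAdd (cfgShift d _ f.toAdd) = f
    refine Multiplicative.toAdd.injective ?_
    ext v
    simp only [toAdd_ofAdd]
    rw [cfgShift_apply]
    norm_num
  map_mul' u v := by
    refine MulEquiv.ext fun f => ?_
    show Multiplicative.ofAdd (cfgShift d _ f.toAdd)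
      = Multiplicative.ofAdd (cfgShift d _ (cfgShift d _ f.toAdd))
    refine congrArg _ ?_
    ext w
    rw [cfgShift_apply, cfgShift_apply, cfgShift_apply]
    rw [show (u * v).toAdd = u.toAdd + v.toAdd from rfl, sub_sub]

/-- The lamplighter group `ℤ^d ≀ ℤ = (⊕_{v ∈ ℤ^d} ℤ) ⋊ ℤ^d`. -/
abbrev Lamp (d : ℕ) : Type :=
  Multiplicative (Cfg d) ⋊[lampAut d] Multiplicative (Pt d)

/-- The base generator `s_i = (0, e_i)`. -/
noncomputable def lampS (d : ℕ) (i : Fin d) : Lamp d :=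
  ⟨1, Multiplicative.ofAdd (latE d i)⟩

/-- The lamp generator `t = (δ₀, 0)`. -/
noncomputable def lampT (d : ℕ) : Lamp d :=
  ⟨Multiplicative.ofAdd (Finsupp.single 0 1), 1⟩

/-- The `d + 1` standard generators of the lamplighter group: `x_i ↦ s_i` for `i < d` and
`x_{d+1} ↦ t`. -/
noncomputable def lampGen (d : ℕ) (i : Fin (d + 1)) : Lamp d :=
  if h : (i : ℕ) < d then lampS d ⟨i, h⟩ else lampT d

/-- The element of the lamplighter group spelled by a word in the generators
`s_1^{±1}, …, s_d^{±1}, t^{±1}`. -/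
noncomputable def lampWordProd (d : ℕ) (w : List (Fin (d + 1) × Bool)) : Lamp d :=
  (w.map fun l => if l.2 then lampGen d l.1 else (lampGen d l.1)⁻¹).prod
open MeasureTheory in
/-- `μ` is the Bernoulli product on `ℕ → S` of the uniform measure on the finite set `S`:
it is a probability measure under which the coordinates are i.i.d. uniform on `S`, i.e.
every cylinder of length `n` has measure `|S|^{-n}`. -/
def IsUniformBernoulli (S : Type*) [Fintype S] [MeasurableSpace S]
    (μ : Measure (ℕ → S)) : Prop :=
  IsProbabilityMeasure μ ∧
    ∀ (n : ℕ) (f : Fin n → S),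
      μ {ω | ∀ k : Fin n, ω (k : ℕ) = f k} = ((Fintype.card S : ENNReal))⁻¹ ^ n

/-- The position of the lamplighter random walk after `n` steps: the product of the first
`n` increments. -/
noncomputable def lampWalk (d : ℕ) (ω : ℕ → Fin (d + 1) × Bool) (n : ℕ) : Lamp d :=
  lampWordProd d (List.ofFn fun k : Fin n => ω (k : ℕ))

/-- The lamp configuration component `φ_n` of the lamplighter walk at time `n`. -/
noncomputable def lampCfg (d : ℕ) (ω : ℕ → Fin (d + 1) × Bool) (n : ℕ) : Cfg d :=
  ((lampWalk d ω n).left).toAdd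

open Classical in
/-- The final (stabilized) lamp configuration `Φ_∞(ω) : ℤ^d → ℤ` of the lamplighter walk,
defined (arbitrarily as `0`) at points where the lamp value does not stabilize. -/
noncomputable def lampFinal (d : ℕ) (ω : ℕ → Fin (d + 1) × Bool) (v : Pt d) : ℤ :=
  if h : ∃ N : ℕ, ∀ n : ℕ, N ≤ n → lampCfg d ω n v = lampCfg d ω N v
  then lampCfg d ω h.choose v
  else 0

/-- The tail σ-algebra `⋂_N σ(g_N, g_{N+1}, …)` of the lamplighter random walk, where the
lamplighter group carries the discrete σ-algebra. -/
noncomputable def lampTail (d : ℕ) : MeasurableSpace (ℕ → Fin (d + 1) × Bool) :=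
  ⨅ N : ℕ, ⨆ n : ℕ, MeasurableSpace.comap (fun ω => lampWalk d ω (N + n)) ⊤

namespace LL
open MeasureTheory Set

section Basic
variable {S : Type*} [Fintype S] [MeasurableSpace S] [MeasurableSingletonClass S]

/-- Shift of a sequence. -/
def shf {S : Type*} (n : ℕ) (ω : ℕ → S) : ℕ → S := fun i => ω (n + i)

/-- Prefix of a sequence. -/
def pre {S : Type*} (n : ℕ) (ω : ℕ → S) : Fin n → S := fun k => ω k

lemma measurable_shf (n : ℕ) : Measurable (shf n : (ℕ → S) → ℕ → S) :=
  measurable_pi_lambda _ fun _ => measurable_pi_apply _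

lemma measurable_pre (n : ℕ) : Measurable (pre n : (ℕ → S) → Fin n → S) :=
  measurable_pi_lambda _ fun _ => measurable_pi_apply _

lemma measurableSet_pre (n : ℕ) (T : Set (Fin n → S)) :
    MeasurableSet (pre n ⁻¹' T : Set (ℕ → S)) :=
  measurable_pre n (Set.toFinite T).measurableSet

lemma pre_eq_iff {n : ℕ} {ω : ℕ → S} {f : Fin n → S} :
    pre n ω = f ↔ ∀ k : Fin n, ω k = f k := funext_iff

lemma ext_cyl (μ ν : Measure (ℕ → S)) [IsFiniteMeasure μ]
    (h : ∀ n (f : Fin n → S), μ (pre n ⁻¹' {f}) = ν (pre n ⁻¹' {f})) : μ = ν := by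
  classical
  refine ext_of_generate_finite
    ({∅} ∪ {s | ∃ n, ∃ f : Fin n → S, s = pre n ⁻¹' {f}}) ?_ ?_ ?_ ?_
  · apply le_antisymm
    · refine iSup_le fun i => ?_
      rintro _ ⟨s, -, rfl⟩
      have : ((fun b : ℕ → S => b i) ⁻¹' s) =
          ⋃ f ∈ {f : Fin (i+1) → S | f (Fin.last i) ∈ s}, pre (i+1) ⁻¹' {f} := by
        ext ω
        simp only [mem_preimage, mem_setOf_eq, mem_iUnion, mem_singleton_iff, exists_prop]
        constructor
        · intro h; exact ⟨pre (i+1) ω, h, rfl⟩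
        · rintro ⟨f, hf, rfl⟩; exact hf
      rw [this]
      refine @MeasurableSet.biUnion _ _ (MeasurableSpace.generateFrom _) _ _ (Set.to_countable _) fun f _ => ?_
      exact MeasurableSpace.measurableSet_generateFrom (Or.inr ⟨_, f, rfl⟩)
    · refine MeasurableSpace.generateFrom_le ?_
      rintro t (rfl | ⟨n, f, rfl⟩)
      · exact MeasurableSet.empty
      · exact measurableSet_pre _ _
  · have key : ∀ n m (f : Fin n → S) (g : Fin m → S), n ≤ m →
        (pre n ⁻¹' {f} ∩ pre m ⁻¹' {g} : Set (ℕ → S)).Nonempty →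
        (pre n ⁻¹' {f} ∩ pre m ⁻¹' {g} : Set (ℕ → S)) = pre m ⁻¹' {g} := by
      rintro n m f g hnm ⟨ω, h1, h2⟩
      apply Set.inter_eq_right.2
      intro ω' h'
      simp only [mem_preimage, mem_singleton_iff, pre_eq_iff] at *
      intro k
      have e1 := h2 ⟨k, by omega⟩
      have e2 := h' ⟨k, by omega⟩
      simp only at e1 e2
      rw [← h1 k, e1, e2]
    rintro s (rfl | ⟨n, f, rfl⟩) t (rfl | ⟨m, g, rfl⟩) hst
    · simp at hst
    · simp at hst
    · simp at hst
    · rcases le_total n m with hl | hl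
      · rw [key n m f g hl hst]; exact Or.inr ⟨m, g, rfl⟩
      · rw [inter_comm, key m n g f hl (by rwa [inter_comm])]; exact Or.inr ⟨n, f, rfl⟩
  · rintro s (rfl | ⟨n, f, rfl⟩)
    · simp
    · exact h n f
  · have := h 0 (fun k => k.elim0)
    have e : (pre 0 ⁻¹' {fun k => k.elim0} : Set (ℕ → S)) = univ := by
      ext ω; simp [pre_eq_iff]
    rwa [e] at this

variable {μ : Measure (ℕ → S)}

lemma cyl_meas (hμ : IsUniformBernoulli S μ) (n : ℕ) (f : Fin n → S) :
    μ (pre n ⁻¹' {f}) = ((Fintype.card S : ENNReal))⁻¹ ^ n := by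
  rw [← hμ.2 n f]; congr 1; ext ω; simp [pre_eq_iff]

lemma map_restrict_word (hμ : IsUniformBernoulli S μ) (n : ℕ) (w : Fin n → S) :
    (μ.restrict (pre n ⁻¹' {w})).map (shf n) = (μ (pre n ⁻¹' {w})) • μ := by
  haveI := hμ.1
  haveI : IsFiniteMeasure ((μ.restrict (pre n ⁻¹' {w})).map (shf n)) :=
    Measure.isFiniteMeasure_map _ _
  refine ext_cyl _ _ fun m f => ?_
  rw [Measure.map_apply (measurable_shf n) (measurableSet_pre _ _),
    Measure.restrict_apply (measurable_shf n (measurableSet_pre _ _)),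
    Measure.smul_apply, cyl_meas hμ, cyl_meas hμ, smul_eq_mul, ← pow_add,
    ← cyl_meas hμ (n+m) (Fin.append w f)]
  congr 1
  ext ω
  simp only [mem_inter_iff, mem_preimage, mem_singleton_iff, pre_eq_iff]
  constructor
  · rintro ⟨h1, h2⟩ k
    refine Fin.addCases (fun i => ?_) (fun i => ?_) k
    · simpa using h2 i
    · simpa [shf] using h1 i
  · intro h
    refine ⟨fun k => ?_, fun k => ?_⟩
    · simpa [shf] using h (Fin.natAdd n k)
    · simpa using h (Fin.castAdd m k)

lemma map_restrict_pre (hμ : IsUniformBernoulli S μ) (n : ℕ) (T : Set (Fin n → S)) :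
    (μ.restrict (pre n ⁻¹' T)).map (shf n) = (μ (pre n ⁻¹' T)) • μ := by
  classical
  haveI := hμ.1
  have hT : (pre n ⁻¹' T : Set (ℕ → S)) = ⋃ w : T, pre n ⁻¹' {w.1} := by
    ext ω; simp
  have hd : Pairwise (Function.onFun Disjoint fun w : T => (pre n ⁻¹' {w.1} : Set (ℕ → S))) := by
    intro a b hab
    rw [Function.onFun, Set.disjoint_left]
    rintro ω h1 h2
    simp only [mem_preimage, mem_singleton_iff] at h1 h2
    exact hab (Subtype.ext (h1.symm.trans h2))
  have hm : ∀ w : T, MeasurableSet (pre n ⁻¹' {w.1} : Set (ℕ → S)) :=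
    fun w => measurableSet_pre _ _
  ext A hA
  rw [Measure.map_apply (measurable_shf n) hA, Measure.restrict_apply (measurable_shf n hA),
    Measure.smul_apply, smul_eq_mul, hT, inter_iUnion,
    measure_iUnion (fun a b hab => (hd hab).mono inter_subset_right inter_subset_right)
      (fun w => (measurable_shf n hA).inter (hm w)), measure_iUnion hd hm, ← ENNReal.tsum_mul_right]
  congr 1; ext w
  have := congrArg (fun m => m A) (map_restrict_word hμ n w.1)
  simp only [Measure.smul_apply, smul_eq_mul] at this
  rw [← this, Measure.map_apply (measurable_shf n) hA, Measure.restrict_apply (measurable_shf n hA)]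

lemma mp_shf (hμ : IsUniformBernoulli S μ) (n : ℕ) : MeasurePreserving (shf n) μ μ := by
  haveI := hμ.1
  refine ⟨measurable_shf n, ?_⟩
  have := map_restrict_pre hμ n univ
  simpa using this

/-- Independence of prefix and shifted sequence, integral form. -/
lemma setIntegral_shf (hμ : IsUniformBernoulli S μ) (n : ℕ) (T : Set (Fin n → S))
    (g : (ℕ → S) → ℝ) (hg : AEStronglyMeasurable g μ) :
    ∫ ω in pre n ⁻¹' T, g (shf n ω) ∂μ = μ.real (pre n ⁻¹' T) * ∫ ω, g ω ∂μ := by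
  have e := map_restrict_pre hμ n T
  rw [← integral_map (f := g) (measurable_shf n).aemeasurable, e, integral_smul_measure]
  · rfl
  · rw [e]; exact hg.smul_measure _

end Basic
end LL

namespace LL
open MeasureTheory Set

variable {d : ℕ}

lemma walk_add (ω : ℕ → Fin (d + 1) × Bool) (n m : ℕ) :
    lampWalk d ω (n + m) = lampWalk d ω n * lampWalk d (shf n ω) m := by
  unfold lampWalk lampWordProd shf
  rw [← List.prod_append, ← List.map_append]
  congr 2
  rw [List.ofFn_add]
  rfl

lemma walk_zero (ω : ℕ → Fin (d + 1) × Bool) : lampWalk d ω 0 = 1 := by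
  simp [lampWalk, lampWordProd]

/-- The group element of a word. -/
noncomputable def W (n : ℕ) (w : Fin n → Fin (d + 1) × Bool) : Lamp d :=
  lampWordProd d (List.ofFn w)

lemma walk_eq (ω : ℕ → Fin (d + 1) × Bool) (n : ℕ) : lampWalk d ω n = W n (pre n ω) := rfl

/-- Base position. -/
noncomputable def pos (n : ℕ) (ω : ℕ → Fin (d + 1) × Bool) : Pt d := (lampWalk d ω n).right.toAdd

/-- Action of the group on configurations. -/
def act (g : Lamp d) (z : Pt d → ℤ) : Pt d → ℤ := fun v => g.left.toAdd v + z (v - g.right.toAdd)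

lemma left_mul (g h : Lamp d) (v : Pt d) : (g * h).left.toAdd v
    = g.left.toAdd v + h.left.toAdd (v - g.right.toAdd) := by
  rw [SemidirectProduct.mul_left]; rfl

lemma right_mul (g h : Lamp d) : (g * h).right.toAdd = g.right.toAdd + h.right.toAdd := rfl

lemma act_mul (g h : Lamp d) (z : Pt d → ℤ) : act (g * h) z = act g (act h z) := by
  funext v
  simp only [act, left_mul, right_mul, add_assoc, sub_sub]

lemma act_one (z : Pt d → ℤ) : act 1 z = z := by
  funext v
  show (0 : Cfg d) v + z (v - 0) = z v
  simp

lemma act_inv_act (g : Lamp d) (z : Pt d → ℤ) : act g⁻¹ (act g z) = z := by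
  rw [← act_mul, inv_mul_cancel, act_one]

lemma act_act_inv (g : Lamp d) (z : Pt d → ℤ) : act g (act g⁻¹ z) = z := by
  rw [← act_mul, mul_inv_cancel, act_one]

lemma measurable_act (g : Lamp d) : Measurable (act g) := by
  refine measurable_pi_lambda _ fun v => ?_
  exact (measurable_pi_apply (v - g.right.toAdd)).const_add _

lemma pos_add (ω : ℕ → Fin (d + 1) × Bool) (n m : ℕ) :
    pos (n + m) ω = pos n ω + pos m (shf n ω) := by
  rw [pos, walk_add, right_mul]; rfl

lemma pos_zero (ω : ℕ → Fin (d + 1) × Bool) : pos 0 ω = 0 := by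
  rw [pos, walk_zero]; rfl

lemma cfg_add (ω : ℕ → Fin (d + 1) × Bool) (n m : ℕ) (v : Pt d) :
    lampCfg d ω (n + m) v = lampCfg d ω n v + lampCfg d (shf n ω) m (v - pos n ω) := by
  rw [lampCfg, walk_add, left_mul]; rfl

lemma cfg_zero (ω : ℕ → Fin (d + 1) × Bool) (v : Pt d) : lampCfg d ω 0 v = 0 := by
  rw [lampCfg, walk_zero]; rfl

/-- The base step of a letter. -/
noncomputable def stp (s : Fin (d + 1) × Bool) : Pt d :=
  if h : (s.1 : ℕ) < d then (if s.2 then latE d ⟨s.1, h⟩ else - latE d ⟨s.1, h⟩) else 0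

lemma walk_one (ω : ℕ → Fin (d + 1) × Bool) :
    lampWalk d ω 1 = if (ω 0).2 then lampGen d (ω 0).1 else (lampGen d (ω 0).1)⁻¹ := by
  simp [lampWalk, lampWordProd]

lemma pos_one (ω : ℕ → Fin (d + 1) × Bool) : pos 1 ω = stp (ω 0) := by
  rw [pos, walk_one, stp]
  by_cases h : ((ω 0).1 : ℕ) < d <;> by_cases hb : (ω 0).2 <;>
    simp only [h, hb, lampGen, lampS, lampT, dif_pos, dif_neg, if_pos, if_neg, not_false_iff,
      SemidirectProduct.inv_right] <;> rfl

lemma cfg_one (ω : ℕ → Fin (d + 1) × Bool) (v : Pt d) :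
    |lampCfg d ω 1 v| ≤ if v = 0 then 1 else 0 := by
  rw [lampCfg, walk_one]
  by_cases h : ((ω 0).1 : ℕ) < d <;> by_cases hb : (ω 0).2
  · rw [if_pos hb, lampGen, dif_pos h]
    show |(0 : Cfg d) v| ≤ _
    split_ifs <;> simp
  · rw [if_neg hb, lampGen, dif_pos h, SemidirectProduct.inv_left]
    have : (lampS d ⟨(ω 0).1, h⟩).left = 1 := rfl
    rw [this, inv_one, map_one]
    show |(0 : Cfg d) v| ≤ _
    split_ifs <;> simp
  · rw [if_pos hb, lampGen, dif_neg h]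
    show |(Finsupp.single 0 1 : Cfg d) v| ≤ _
    rw [Finsupp.single_apply]
    by_cases hv : v = 0
    · simp [hv]
    · rw [if_neg hv, if_neg (Ne.symm hv)]; simp
  · rw [if_neg hb, lampGen, dif_neg h, SemidirectProduct.inv_left]
    have : (lampT d).right = 1 := rfl
    rw [this, inv_one, map_one]
    show |(- Finsupp.single 0 1 : Cfg d) v| ≤ _
    rw [Finsupp.neg_apply, Finsupp.single_apply]
    by_cases hv : v = 0
    · simp [hv]
    · rw [if_neg hv, if_neg (Ne.symm hv)]; simp

lemma cfg_step (ω : ℕ → Fin (d + 1) × Bool) (n : ℕ) (v : Pt d) :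
    |lampCfg d ω (n + 1) v - lampCfg d ω n v| ≤ if pos n ω = v then 1 else 0 := by
  rw [cfg_add, add_sub_cancel_left]
  refine (cfg_one _ _).trans (le_of_eq ?_)
  congr 1
  exact propext (sub_eq_zero.trans eq_comm)

lemma cfg_diff (ω : ℕ → Fin (d + 1) × Bool) (n m : ℕ) (v : Pt d) :
    |lampCfg d ω (n + m) v - lampCfg d ω n v|
      ≤ ∑ i ∈ Finset.range m, if pos (n + i) ω = v then 1 else 0 := by
  induction m with
  | zero => simp
  | succ m ih =>
    rw [Finset.sum_range_succ]
    have := cfg_step ω (n + m) v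
    calc _ = |(lampCfg d ω (n + m + 1) v - lampCfg d ω (n + m) v)
          + (lampCfg d ω (n + m) v - lampCfg d ω n v)| := by rw [← add_assoc]; congr 1; ring
      _ ≤ _ := (abs_add_le _ _).trans (by linarith)

lemma cfg_ne_zero (ω : ℕ → Fin (d + 1) × Bool) (n : ℕ) (v : Pt d) (h : lampCfg d ω n v ≠ 0) :
    ∃ t < n, pos t ω = v := by
  by_contra hc
  push Not at hc
  have := cfg_diff ω 0 n v
  rw [zero_add, cfg_zero, sub_zero, Finset.sum_eq_zero] at this
  · exact h (abs_eq_zero.1 (le_antisymm this (abs_nonneg _)))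
  · intro i hi
    rw [zero_add, if_neg (hc i (Finset.mem_range.1 hi))]

lemma stp_le (s : Fin (d + 1) × Bool) (i : Fin d) : |stp s i| ≤ 1 := by
  unfold stp latE
  split_ifs <;> simp <;> split_ifs <;> simp

lemma pos_le (n : ℕ) : ∀ (ω : ℕ → Fin (d + 1) × Bool) (i : Fin d), |pos n ω i| ≤ n := by
  induction n with
  | zero => intro ω i; simp [pos_zero]
  | succ n ih =>
    intro ω i
    rw [pos_add, pos_one, Pi.add_apply]
    push_cast
    exact (abs_add_le _ _).trans (add_le_add (ih _ _) (stp_le _ _))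

lemma W_append {n m : ℕ} (w : Fin n → Fin (d + 1) × Bool) (w' : Fin m → Fin (d + 1) × Bool) :
    W (n + m) (Fin.append w w') = W n w * W m w' := by
  unfold W lampWordProd
  rw [← List.prod_append, ← List.map_append, List.ofFn_fin_append]

lemma W_inv {n : ℕ} (w : Fin n → Fin (d + 1) × Bool) :
    ∃ m, ∃ w' : Fin m → Fin (d + 1) × Bool, W m w' = (W n w)⁻¹ := by
  have key : ∀ l : List (Fin (d + 1) × Bool), ∃ l', lampWordProd d l' = (lampWordProd d l)⁻¹ := by
    intro l
    induction l with
    | nil => exact ⟨[], by simp [lampWordProd]⟩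
    | cons a l ih =>
      obtain ⟨l', hl'⟩ := ih
      refine ⟨l' ++ [(a.1, !a.2)], ?_⟩
      unfold lampWordProd at *
      rw [List.map_append, List.prod_append, hl']
      simp only [List.map_cons, List.prod_cons, mul_inv_rev, List.map_nil, List.prod_nil, mul_one]
      congr 1
      cases a.2 <;> simp
  obtain ⟨l', hl'⟩ := key (List.ofFn w)
  refine ⟨l'.length, l'.get, ?_⟩
  unfold W
  rw [List.ofFn_get, hl']

def Rch (a : Lamp d) : Prop := ∃ n, ∃ w : Fin n → Fin (d + 1) × Bool, W n w = a

lemma Rch.inv {a : Lamp d} (h : Rch a) : Rch a⁻¹ := by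
  obtain ⟨n, w, rfl⟩ := h; exact W_inv w

lemma Rch.mul {a b : Lamp d} (h : Rch a) (h' : Rch b) : Rch (a * b) := by
  obtain ⟨n, w, rfl⟩ := h; obtain ⟨m, w', rfl⟩ := h'; exact ⟨_, _, W_append w w'⟩

lemma rch_walk (ω : ℕ → Fin (d + 1) × Bool) (n : ℕ) : Rch (lampWalk d ω n) := ⟨n, pre n ω, rfl⟩

lemma walk_set (n : ℕ) (P : Lamp d → Prop) :
    {ω | P (lampWalk d ω n)} = pre n ⁻¹' {w | P (W n w)} := rfl

lemma measurableSet_walk (n : ℕ) (P : Lamp d → Prop) :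
    MeasurableSet {ω | P (lampWalk d ω n)} := by
  rw [walk_set]; exact measurableSet_pre _ _

lemma measurable_walk_comp {β : Type*} [MeasurableSpace β] (n : ℕ) (f : Lamp d → β) :
    Measurable fun ω => f (lampWalk d ω n) := by
  intro s _
  exact measurableSet_walk n (fun a => f a ∈ s)

end LL

namespace LL
open MeasureTheory Set

lemma pow_bds (u : ℝ) (h1 : -(1/2) ≤ u) (h2 : u ≤ 1/2) :
    0 ≤ u^2 ∧ u^2 ≤ 1/4 ∧ -(1/8) ≤ u^3 ∧ u^3 ≤ 1/8 ∧ 0 ≤ u^4 ∧ -(1/32) ≤ u^5 := by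
  have a2 : u^2 ≤ 1/4 := by nlinarith
  have a3 : |u^3| ≤ 1/8 := by
    rw [abs_pow]
    have : |u| ≤ 1/2 := abs_le.2 ⟨h1, h2⟩
    calc |u|^3 ≤ (1/2)^3 := pow_le_pow_left₀ (abs_nonneg _) this 3
      _ = _ := by norm_num
  have a5 : |u^5| ≤ 1/32 := by
    rw [abs_pow]
    have : |u| ≤ 1/2 := abs_le.2 ⟨h1, h2⟩
    calc |u|^5 ≤ (1/2)^5 := pow_le_pow_left₀ (abs_nonneg _) this 5
      _ = _ := by norm_num
  exact ⟨by positivity, a2, (abs_le.1 a3).1, (abs_le.1 a3).2, by positivity, (abs_le.1 a5).1⟩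

lemma poly1 (u : ℝ) (h1 : -(1/2) ≤ u) (h2 : u ≤ 1/2) :
    1 ≤ (1 - u/2 + 3*u^2/8 - 5*u^3/16 + u^4)^2 * (1 + u) := by
  obtain ⟨b1, b2, b3, b4, b5, b6⟩ := pow_bds u h1 h2
  have key : (1 - u/2 + 3*u^2/8 - 5*u^3/16 + u^4)^2 * (1 + u) - 1
    = u^4 * (93/64 + 39/32*u - 99/256*u^2 + 57/256*u^3 + 3/8*u^4 + u^5) := by ring
  have : 0 ≤ 93/64 + 39/32*u - 99/256*u^2 + 57/256*u^3 + 3/8*u^4 + u^5 := by linarith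
  have := mul_nonneg b5 this
  linarith

lemma poly2 (u : ℝ) (h1 : -(1/2) ≤ u) (h2 : u ≤ 1/2) :
    1 - u/2 + 3*u^2/8 - 5*u^3/16 + u^4 ≤ (1 - u/4 + 5*u^2/32 - 15*u^3/128 + u^4)^2 := by
  obtain ⟨b1, b2, b3, b4, b5, b6⟩ := pow_bds u h1 h2
  have key : (1 - u/4 + 5*u^2/32 - 15*u^3/128 + u^4)^2 - (1 - u/2 + 3*u^2/8 - 5*u^3/16 + u^4)
    = u^4 * (1109/1024 - 1099/2048*u + 5345/16384*u^2 - 15/64*u^3 + u^4) := by ring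
  have : 0 ≤ 1109/1024 - 1099/2048*u + 5345/16384*u^2 - 15/64*u^3 + u^4 := by linarith
  have := mul_nonneg b5 this
  linarith

lemma qroot (r u : ℝ) (hr : 0 < r) (h1 : -(1/2) ≤ u) (h2 : u ≤ 1/2) :
    (√(√(r * (1 + u))))⁻¹ ≤ (√(√r))⁻¹ * (1 - u/4 + 5*u^2/32 - 15*u^3/128 + u^4) := by
  obtain ⟨b1, b2, b3, b4, b5, b6⟩ := pow_bds u h1 h2
  set B := 1 - u/4 + 5*u^2/32 - 15*u^3/128 + u^4 with hB
  set B1 := 1 - u/2 + 3*u^2/8 - 5*u^3/16 + u^4 with hB1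
  have hBp : 0 < B := by rw [hB]; linarith
  have hB1p : 0 < B1 := by rw [hB1]; linarith
  have hu : 0 < 1 + u := by linarith
  have e1 : 1 ≤ B1 * √(1+u) := by
    have := poly1 u h1 h2
    have h3 : (B1 * √(1+u))^2 = B1^2 * (1+u) := by rw [mul_pow, Real.sq_sqrt hu.le]
    have : 1 ≤ (B1 * √(1+u))^2 := by rw [h3]; exact this
    nlinarith [mul_nonneg hB1p.le (Real.sqrt_nonneg (1+u))]
  have e2 : 1 ≤ B * √(√(1+u)) := by
    have := poly2 u h1 h2
    have h3 : (B * √(√(1+u)))^2 = B^2 * √(1+u) := by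
      rw [mul_pow, Real.sq_sqrt (Real.sqrt_nonneg _)]
    have : 1 ≤ (B * √(√(1+u)))^2 := by
      rw [h3]
      exact e1.trans (mul_le_mul_of_nonneg_right this (Real.sqrt_nonneg _))
    nlinarith [mul_nonneg hBp.le (Real.sqrt_nonneg (√(1+u)))]
  rw [Real.sqrt_mul hr.le, Real.sqrt_mul (Real.sqrt_nonneg _), mul_inv]
  have hp : 0 < √(√(1+u)) := Real.sqrt_pos.2 (Real.sqrt_pos.2 hu)
  refine mul_le_mul_of_nonneg_left ?_ (by positivity)
  rw [inv_le_iff_one_le_mul₀ hp]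
  exact e2

/-- The Lyapunov function. -/
noncomputable def lyap {d : ℕ} (v : Pt d) : ℝ := (√(√(1000 + ∑ i, (v i : ℝ)^2)))⁻¹

variable {d : ℕ}

lemma lyap_pos (v : Pt d) : 0 < lyap v := by
  unfold lyap
  have : 0 ≤ ∑ i, (v i : ℝ)^2 := Finset.sum_nonneg fun i _ => sq_nonneg _
  exact inv_pos.2 (Real.sqrt_pos.2 (Real.sqrt_pos.2 (by linarith)))

lemma sq_shift (v : Pt d) (i : Fin d) (e : ℤ) :
    ∑ j, (((v + e • latE d i) j : ℤ) : ℝ)^2 = ∑ j, (v j : ℝ)^2 + (2 * e * v i + e^2) := by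
  have : ∀ j, (((v + e • latE d i) j : ℤ) : ℝ)^2
      = (v j : ℝ)^2 + if j = i then (2 * e * v i + e^2 : ℝ) else 0 := by
    intro j
    simp only [latE, Pi.add_apply, Pi.smul_apply, smul_eq_mul]
    split_ifs with h
    · subst h; push_cast; ring
    · simp
  simp_rw [this, Finset.sum_add_distrib]
  simp

lemma lyap_pair (v : Pt d) (i : Fin d) (r : ℝ) (hr : r = 1000 + ∑ i, (v i : ℝ)^2) :
    lyap (v + latE d i) + lyap (v - latE d i) ≤ lyap v *
      (2 - 1/2/r + 5/16/r^2 + 5/4 * (v i : ℝ)^2/r^2 + 2/r^4 + 48*(v i:ℝ)^2/r^4 + 32*(v i:ℝ)^4/r^4) := by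
  have hle : (v i : ℝ)^2 ≤ ∑ i, (v i : ℝ)^2 :=
    Finset.single_le_sum (f := fun i => (v i : ℝ)^2) (fun i _ => sq_nonneg _) (Finset.mem_univ i)
  set x : ℝ := (v i : ℝ) with hx
  have hr0 : 1000 ≤ r := by nlinarith [sq_nonneg x]
  have hrp : 0 < r := by linarith
  have hxr : x^2 + 1000 ≤ r := by linarith
  have f1 := sq_shift v i 1
  have f2 := sq_shift v i (-1)
  simp only [one_smul, neg_smul, ← sub_eq_add_neg] at f1 f2
  have g1 : 1000 + ∑ j, (((v + latE d i) j : ℤ) : ℝ)^2 = r * (1 + (2*x+1)/r) := by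
    rw [f1, hr]; rw [hr] at hrp; field_simp; push_cast; ring
  have g2 : 1000 + ∑ j, (((v - latE d i) j : ℤ) : ℝ)^2 = r * (1 + (-2*x+1)/r) := by
    rw [f2, hr]; rw [hr] at hrp; field_simp; push_cast; ring
  have q1 := qroot r ((2*x+1)/r) hrp (by rw [le_div_iff₀ hrp]; nlinarith [sq_nonneg (x+1), sq_nonneg (x+2)])
    (by rw [div_le_iff₀ hrp]; nlinarith [sq_nonneg (x-2)])
  have q2 := qroot r ((-2*x+1)/r) hrp (by rw [le_div_iff₀ hrp]; nlinarith [sq_nonneg (x-2)])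
    (by rw [div_le_iff₀ hrp]; nlinarith [sq_nonneg (x+2)])
  unfold lyap
  rw [g1, g2, ← hr]
  refine (add_le_add q1 q2).trans ?_
  rw [← mul_add]
  refine mul_le_mul_of_nonneg_left ?_ (by positivity)
  have : 0 ≤ 15/64 * (1 + 12*x^2)/r^3 := by positivity
  have e : 1 - (2 * x + 1) / r / 4 + 5 * ((2 * x + 1) / r) ^ 2 / 32 - 15 * ((2 * x + 1) / r) ^ 3 / 128 +
        ((2 * x + 1) / r) ^ 4 +
      (1 - (-2 * x + 1) / r / 4 + 5 * ((-2 * x + 1) / r) ^ 2 / 32 - 15 * ((-2 * x + 1) / r) ^ 3 / 128 +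
        ((-2 * x + 1) / r) ^ 4) =
    2 - 1 / 2 / r + 5 / 16 / r ^ 2 + 5 / 4 * x ^ 2 / r ^ 2 + 2 / r ^ 4 + 48 * x ^ 2 / r ^ 4 + 32 * x ^ 4 / r ^ 4
     - 15/64 * (1 + 12*x^2)/r^3 := by
    field_simp; ring
  linarith

lemma lyap_sum (hd : 3 ≤ d) (v : Pt d) :
    ∑ i, (lyap (v + latE d i) + lyap (v - latE d i)) < 2 * d * lyap v := by
  set R : ℝ := ∑ i, (v i : ℝ)^2 with hR
  have hR0 : 0 ≤ R := Finset.sum_nonneg fun i _ => sq_nonneg _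
  set r : ℝ := 1000 + R with hr
  have hrp : 0 < r := by linarith
  have hx4 : ∑ i, (v i : ℝ)^4 ≤ R^2 := by
    rw [sq, hR, Finset.sum_mul]
    refine Finset.sum_le_sum fun i _ => ?_
    have : (v i : ℝ)^2 ≤ ∑ i, (v i : ℝ)^2 :=
      Finset.single_le_sum (f := fun i => (v i : ℝ)^2) (fun i _ => sq_nonneg _) (Finset.mem_univ i)
    nlinarith [sq_nonneg (v i : ℝ)]
  have hD : (3:ℝ) ≤ d := by exact_mod_cast hd
  calc ∑ i, (lyap (v + latE d i) + lyap (v - latE d i)) ≤ ∑ i, lyap v *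
      (2 - 1/2/r + 5/16/r^2 + 5/4 * (v i : ℝ)^2/r^2 + 2/r^4 + 48*(v i:ℝ)^2/r^4 + 32*(v i:ℝ)^4/r^4) :=
        Finset.sum_le_sum fun i _ => lyap_pair v i r rfl
    _ = lyap v * (d * (2 - 1/2/r + 5/16/r^2 + 2/r^4) + (5/4/r^2 + 48/r^4) * R
          + 32/r^4 * ∑ i, (v i:ℝ)^4) := by
        rw [← Finset.mul_sum, hR]
        congr 1
        simp only [Finset.sum_add_distrib, Finset.sum_const, Finset.card_univ, Fintype.card_fin,
          nsmul_eq_mul, Finset.sum_sub_distrib, Finset.mul_sum, add_mul]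
        have e1 : ∑ i, 5 / 4 * (v i:ℝ) ^ 2 / r ^ 2 = ∑ i, 5 / 4 / r ^ 2 * (v i:ℝ) ^ 2 :=
          Finset.sum_congr rfl fun i _ => by ring
        have e2 : ∑ i, 48 * (v i:ℝ) ^ 2 / r ^ 4 = ∑ i, 48 / r ^ 4 * (v i:ℝ) ^ 2 :=
          Finset.sum_congr rfl fun i _ => by ring
        have e3 : ∑ i, 32 * (v i:ℝ) ^ 4 / r ^ 4 = ∑ i, 32 / r ^ 4 * (v i:ℝ) ^ 4 :=
          Finset.sum_congr rfl fun i _ => by ring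
        rw [e1, e2, e3]; ring
    _ < lyap v * (2 * d) := by
        refine mul_lt_mul_of_pos_left ?_ (lyap_pos v)
        have h4 : 32/r^4 * ∑ i, (v i:ℝ)^4 ≤ 32/r^4 * r^2 :=
          mul_le_mul_of_nonneg_left (hx4.trans (by nlinarith)) (by positivity)
        have h2 : (5/4/r^2 + 48/r^4) * R ≤ (5/4/r^2 + 48/r^4) * r :=
          mul_le_mul_of_nonneg_left (by linarith) (by positivity)
        have hinv : r⁻¹ ≤ 1/1000 := by
          rw [inv_le_comm₀ hrp (by norm_num)]; linarith
        set y := r⁻¹ with hy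
        have hy0 : 0 < y := inv_pos.2 hrp
        have key : (d:ℝ) * (2 - 1/2*y + 5/16*y^2 + 2*y^4) + (5/4*y + 48*y^3) + 32*y^2 < 2*d := by
          have y2 : y^2 ≤ 1/1000 * y := by nlinarith
          have y3 : y^3 ≤ 1/1000 * y := by nlinarith [sq_nonneg y]
          have y4 : y^4 ≤ 1/1000 * y := by nlinarith [sq_nonneg y, sq_nonneg (y^2), pow_pos hy0 3]
          nlinarith [mul_pos hy0 (by linarith : (0:ℝ) < d)]
        have k1 : (5/4/r^2 + 48/r^4) * r = 5/4*y + 48*y^3 := by rw [hy]; field_simp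
        have k2 : 32/r^4 * r^2 = 32*y^2 := by rw [hy]; field_simp
        have k3 : (d:ℝ) * (2 - 1/2/r + 5/16/r^2 + 2/r^4) = d * (2 - 1/2*y + 5/16*y^2 + 2*y^4) := by
          rw [hy]; field_simp
        linarith
    _ = _ := by ring

lemma sum_letters (f : Pt d → ℝ) (v : Pt d) :
    ∑ s : Fin (d+1) × Bool, f (v + stp s)
      = ∑ i, (f (v + latE d i) + f (v - latE d i)) + 2 * f v := by
  rw [Fintype.sum_prod_type, Fin.sum_univ_castSucc]
  congr 1
  · refine Finset.sum_congr rfl fun i _ => ?_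
    simp [stp, sub_eq_add_neg]
  · simp [stp, two_mul]

lemma lyap_super (hd : 3 ≤ d) (v : Pt d) :
    ∑ s : Fin (d+1) × Bool, lyap (v + stp s) < Fintype.card (Fin (d+1) × Bool) * lyap v := by
  rw [sum_letters]
  have := lyap_sum hd v
  simp only [Fintype.card_prod, Fintype.card_fin, Fintype.card_bool]
  push_cast
  linarith

variable {μ : Measure (ℕ → Fin (d + 1) × Bool)}

lemma measurableSet_pos (t : ℕ) (P : Pt d → Prop) : MeasurableSet {ω | P (pos t ω)} :=
  measurableSet_walk t (fun a => P a.right.toAdd)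

lemma step_meas (hμ : IsUniformBernoulli (Fin (d + 1) × Bool) μ) (t : ℕ) (x v : Pt d) :
    μ.real {ω | v + pos (t + 1) ω = x}
      = (Fintype.card (Fin (d + 1) × Bool) : ℝ)⁻¹ * ∑ s, μ.real {ω | v + stp s + pos t ω = x} := by
  have := hμ.1
  have hset : {ω : ℕ → Fin (d + 1) × Bool | v + pos (t + 1) ω = x}
      = ⋃ s ∈ (Finset.univ : Finset (Fin (d + 1) × Bool)),
        (shf 1 ⁻¹' {ω | v + stp s + pos t ω = x} ∩ pre 1 ⁻¹' {fun _ => s}) := by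
    ext ω
    simp only [mem_setOf_eq, Finset.mem_univ, iUnion_true, mem_iUnion, mem_inter_iff, mem_preimage,
      mem_singleton_iff]
    rw [add_comm t 1, pos_add, pos_one, ← add_assoc]
    constructor
    · intro h
      refine ⟨ω 0, h, ?_⟩
      funext k
      have : k = 0 := Subsingleton.elim _ _
      subst this; rfl
    · rintro ⟨s, h, h'⟩
      have : ω 0 = s := congrFun h' 0
      rw [this]; exact h
  have hm : ∀ s : Fin (d + 1) × Bool, MeasurableSet (shf 1 ⁻¹' {ω | v + stp s + pos t ω = x}) :=
    fun s => measurable_shf 1 (measurableSet_pos t (fun p => v + stp s + p = x))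
  rw [hset, measureReal_biUnion_finset, Finset.mul_sum]
  · refine Finset.sum_congr rfl fun s _ => ?_
    have e := congrArg (fun m => m.real {ω | v + stp s + pos t ω = x}) (map_restrict_word hμ 1 (fun _ => s))
    rw [map_measureReal_apply (measurable_shf 1) (measurableSet_pos t (fun p => v + stp s + p = x)),
      measureReal_restrict_apply (hm s), measureReal_ennreal_smul_apply, cyl_meas hμ] at e
    rw [e, pow_one, ENNReal.toReal_inv, ENNReal.toReal_natCast]
  · intro a _ b _ hab
    rw [Function.onFun, Set.disjoint_left]
    rintro ω ⟨-, h1⟩ ⟨-, h2⟩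
    exact hab (congrFun (h1.symm.trans h2) 0)
  · intro s _
    exact (hm s).inter (measurableSet_pre _ _)

lemma green_le (hμ : IsUniformBernoulli (Fin (d + 1) × Bool) μ) (hd : 3 ≤ d) (x : Pt d) :
    ∃ C : ℝ, ∀ T, ∑ t ∈ Finset.range T, μ.real {ω | pos t ω = x} ≤ C := by
  have := hμ.1
  set K : ℝ := (Fintype.card (Fin (d + 1) × Bool) : ℝ) with hK
  have hKp : 0 < K := by rw [hK]; exact_mod_cast Fintype.card_pos
  set g : ℝ := lyap x - K⁻¹ * ∑ s, lyap (x + stp s) with hg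
  have hgp : 0 < g := by
    have := lyap_super hd x
    rw [hg, sub_pos, inv_mul_lt_iff₀ hKp]; exact this
  have main : ∀ T (v : Pt d), (∑ t ∈ Finset.range T, μ.real {ω | v + pos t ω = x}) * g ≤ lyap v := by
    intro T
    induction T with
    | zero => intro v; simp [(lyap_pos v).le]
    | succ T ih =>
      intro v
      rw [Finset.sum_range_succ']
      simp only [step_meas hμ, pos_zero, add_zero]
      rw [← Finset.mul_sum, Finset.sum_comm, add_mul, mul_assoc, Finset.sum_mul]
      have h1 : K⁻¹ * ∑ s, (∑ t ∈ Finset.range T, μ.real {ω | v + stp s + pos t ω = x}) * g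
          ≤ K⁻¹ * ∑ s, lyap (v + stp s) :=
        mul_le_mul_of_nonneg_left (Finset.sum_le_sum fun s _ => ih _) (by positivity)
      have h2 : μ.real {ω : ℕ → Fin (d + 1) × Bool | v = x} * g ≤ lyap v - K⁻¹ * ∑ s, lyap (v + stp s) := by
        by_cases h : v = x
        · subst h; simp [hg]
        · simp only [h, setOf_false, measureReal_empty, zero_mul]
          have := lyap_super hd v
          rw [sub_nonneg, inv_mul_le_iff₀ hKp]; exact this.le
      linarith
  refine ⟨lyap (0 : Pt d) / g, fun T => ?_⟩
  rw [le_div_iff₀ hgp]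
  simpa using main T 0

lemma green (hμ : IsUniformBernoulli (Fin (d + 1) × Bool) μ) (hd : 3 ≤ d) (x : Pt d) :
    ∑' t, μ {ω | pos t ω = x} ≠ ⊤ := by
  have := hμ.1
  obtain ⟨C, hC⟩ := green_le hμ hd x
  have : ∑' t, μ {ω | pos t ω = x} ≤ ENNReal.ofReal C := by
    refine ENNReal.tsum_le_of_sum_range_le fun n => ?_
    refine le_trans (le_of_eq ?_) (ENNReal.ofReal_le_ofReal (hC n))
    rw [ENNReal.ofReal_sum_of_nonneg fun _ _ => measureReal_nonneg]
    refine Finset.sum_congr rfl fun t _ => ?_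
    rw [ofReal_measureReal]
  exact ne_top_of_le_ne_top ENNReal.ofReal_ne_top this

end LL

namespace LL
open MeasureTheory Set Filter

variable {d : ℕ}

/-- The final configuration as a map. -/
noncomputable def Zf (ω : ℕ → Fin (d + 1) × Bool) : Pt d → ℤ := fun v => lampFinal d ω v

/-- Transient trajectories. -/
def Good (ω : ℕ → Fin (d + 1) × Bool) : Prop := ∀ v : Pt d, ∀ᶠ n in atTop, pos n ω ≠ v

lemma good_ae {μ : Measure (ℕ → Fin (d + 1) × Bool)}
    (hμ : IsUniformBernoulli (Fin (d + 1) × Bool) μ) (hd : 3 ≤ d) : ∀ᵐ ω ∂μ, Good ω := by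
  unfold Good
  rw [ae_all_iff]
  intro v
  exact ae_eventually_notMem (green hμ hd v)

lemma final_of_eventually {ω : ℕ → Fin (d + 1) × Bool} {v : Pt d} {c : ℤ}
    (h : ∀ᶠ n in atTop, lampCfg d ω n v = c) : lampFinal d ω v = c := by
  obtain ⟨N, hN⟩ := eventually_atTop.1 h
  have hex : ∃ N : ℕ, ∀ n : ℕ, N ≤ n → lampCfg d ω n v = lampCfg d ω N v :=
    ⟨N, fun n hn => by rw [hN n hn, hN N le_rfl]⟩
  rw [lampFinal, dif_pos hex]
  have h2 := hex.choose_spec (max hex.choose N) (le_max_left _ _)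
  rw [← h2]
  exact hN _ (le_max_right _ _)

lemma Good.ev {ω : ℕ → Fin (d + 1) × Bool} (h : Good ω) (v : Pt d) :
    ∀ᶠ n in atTop, lampCfg d ω n v = Zf ω v := by
  obtain ⟨N, hN⟩ := eventually_atTop.1 (h v)
  have : ∀ n, N ≤ n → lampCfg d ω n v = lampCfg d ω N v := by
    intro n hn
    obtain ⟨m, rfl⟩ := Nat.exists_eq_add_of_le hn
    have := cfg_diff ω N m v
    rw [Finset.sum_eq_zero] at this
    · exact sub_eq_zero.1 (abs_eq_zero.1 (le_antisymm this (abs_nonneg _)))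
    · intro i _
      rw [if_neg (hN _ (by omega))]
  have h2 : ∀ᶠ n in atTop, lampCfg d ω n v = lampCfg d ω N v := eventually_atTop.2 ⟨N, this⟩
  unfold Zf
  rw [final_of_eventually h2]
  exact h2

lemma Good.shf {ω : ℕ → Fin (d + 1) × Bool} (h : Good ω) (n : ℕ) : Good (shf n ω) := by
  intro v
  have h1 := h (pos n ω + v)
  have h2 : Tendsto (fun m => n + m) atTop atTop := tendsto_atTop_mono (fun m => Nat.le_add_left m n) tendsto_id
  filter_upwards [h2.eventually h1] with m hm he
  apply hm
  rw [pos_add, he]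

lemma Good.equivar {ω : ℕ → Fin (d + 1) × Bool} (h : Good ω) (n : ℕ) :
    Zf ω = act (lampWalk d ω n) (Zf (LL.shf n ω)) := by
  funext v
  refine final_of_eventually ?_
  have h1 := (h.shf n).ev (v - pos n ω)
  obtain ⟨N, hN⟩ := eventually_atTop.1 h1
  refine eventually_atTop.2 ⟨n + N, fun m hm => ?_⟩
  obtain ⟨k, rfl⟩ := Nat.exists_eq_add_of_le (show n ≤ m by omega)
  rw [cfg_add, hN k (by omega)]
  rfl

lemma measurableSet_cfg (n m : ℕ) (v : Pt d) (P : ℤ → ℤ → Prop) :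
    MeasurableSet {ω | P (lampCfg d ω n v) (lampCfg d ω m v)} := by
  have h1 : Measurable fun ω => lampCfg d ω n v :=
    measurable_walk_comp n (fun a => a.left.toAdd v)
  have h2 : Measurable fun ω => lampCfg d ω m v :=
    measurable_walk_comp m (fun a => a.left.toAdd v)
  exact (h1.prodMk h2) (MeasurableSet.of_discrete (s := {p : ℤ × ℤ | P p.1 p.2}))

lemma measurable_Zf : Measurable (Zf : (ℕ → Fin (d + 1) × Bool) → Pt d → ℤ) := by
  refine measurable_pi_lambda _ fun v => ?_
  refine measurable_to_countable' fun c => ?_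
  have : (fun ω => Zf ω v) ⁻¹' {c} =
      {ω : ℕ → Fin (d + 1) × Bool | ∃ N, ∀ n, N ≤ n → lampCfg d ω n v = c} ∪
      {ω | c = 0 ∧ ¬ ∃ N, ∀ n, N ≤ n → lampCfg d ω n v = lampCfg d ω N v} := by
    ext ω
    simp only [mem_preimage, mem_singleton_iff, mem_union, mem_setOf_eq]
    constructor
    · intro h
      by_cases hex : ∃ N : ℕ, ∀ n : ℕ, N ≤ n → lampCfg d ω n v = lampCfg d ω N v
      · left
        unfold Zf at h
        rw [lampFinal, dif_pos hex] at h
        exact ⟨hex.choose, fun n hn => by rw [hex.choose_spec n hn, h]⟩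
      · right
        unfold Zf at h
        rw [lampFinal, dif_neg hex] at h
        exact ⟨h.symm, hex⟩
    · rintro (h | ⟨h, hex⟩)
      · exact final_of_eventually (eventually_atTop.2 h)
      · unfold Zf
        rw [lampFinal, dif_neg hex, h]
  rw [this]
  refine MeasurableSet.union ?_ (MeasurableSet.inter (MeasurableSet.const _) (MeasurableSet.compl ?_))
  · have : {ω : ℕ → Fin (d + 1) × Bool | ∃ N, ∀ n, N ≤ n → lampCfg d ω n v = c}
      = ⋃ N, ⋂ n, {ω | N ≤ n → lampCfg d ω n v = c} := by ext; simp
    rw [this]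
    refine MeasurableSet.iUnion fun N => MeasurableSet.iInter fun n => ?_
    exact measurableSet_cfg n n v (fun a _ => N ≤ n → a = c)
  · have : {ω : ℕ → Fin (d + 1) × Bool | ∃ N, ∀ n, N ≤ n → lampCfg d ω n v = lampCfg d ω N v}
      = ⋃ N, ⋂ n, {ω | N ≤ n → lampCfg d ω n v = lampCfg d ω N v} := by ext; simp
    change MeasurableSet {ω : ℕ → Fin (d + 1) × Bool | ∃ N, ∀ n, N ≤ n → lampCfg d ω n v = lampCfg d ω N v}
    rw [this]
    refine MeasurableSet.iUnion fun N => MeasurableSet.iInter fun n => ?_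
    exact measurableSet_cfg n N v (fun a b => N ≤ n → a = b)

lemma Good.diff {ω : ℕ → Fin (d + 1) × Bool} (h : Good ω) (n : ℕ) (v : Pt d) :
    ENNReal.ofReal (|((Zf ω v - lampCfg d ω n v : ℤ) : ℝ)|)
      ≤ ∑' i, if pos (n + i) ω = v then 1 else 0 := by
  obtain ⟨N, hN⟩ := eventually_atTop.1 (h.ev v)
  rw [← hN (n + N) (by omega)]
  refine le_trans ?_ (ENNReal.sum_le_tsum (Finset.range N))
  have := cfg_diff ω n N v
  have h2 : |((lampCfg d ω (n + N) v - lampCfg d ω n v : ℤ) : ℝ)|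
      ≤ ∑ i ∈ Finset.range N, if pos (n + i) ω = v then (1:ℝ) else 0 := by
    rw [← Int.cast_abs]
    refine (Int.cast_le.2 this).trans (le_of_eq ?_)
    push_cast; rfl
  refine (ENNReal.ofReal_le_ofReal h2).trans ?_
  rw [ENNReal.ofReal_sum_of_nonneg (fun i _ => by split_ifs <;> norm_num)]
  refine Finset.sum_le_sum fun i _ => ?_
  split_ifs <;> simp

end LL

namespace LL
open MeasureTheory Set Filter

variable {d : ℕ}

/-- Law of the final configuration. -/
noncomputable def nu (μ : Measure (ℕ → Fin (d + 1) × Bool)) : Measure (Pt d → ℤ) := μ.map Zf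

/-- Radon-Nikodym cocycle, extended valued. -/
noncomputable def De (μ : Measure (ℕ → Fin (d + 1) × Bool)) (a : Lamp d) : (Pt d → ℤ) → ENNReal :=
  ((nu μ).map (act a)).rnDeriv (nu μ)

/-- Radon-Nikodym cocycle. -/
noncomputable def D (μ : Measure (ℕ → Fin (d + 1) × Bool)) (a : Lamp d) (z : Pt d → ℤ) : ℝ :=
  (De μ a z).toReal

/-- Law of the walk. -/
noncomputable def p (μ : Measure (ℕ → Fin (d + 1) × Bool)) (n : ℕ) (a : Lamp d) : ℝ :=
  μ.real {ω | lampWalk d ω n = a}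

variable {μ : Measure (ℕ → Fin (d + 1) × Bool)}

lemma measurable_De (a : Lamp d) : Measurable (De μ a) := Measure.measurable_rnDeriv _ _
lemma measurable_D (a : Lamp d) : Measurable (D μ a) := (measurable_De a).ennreal_toReal
lemma D_nonneg (a : Lamp d) (z) : 0 ≤ D μ a z := ENNReal.toReal_nonneg

section
variable (hμ : IsUniformBernoulli (Fin (d + 1) × Bool) μ) (hd : 3 ≤ d)
include hμ

lemma nu_prob : IsProbabilityMeasure (nu μ) := by
  have := hμ.1
  exact Measure.isProbabilityMeasure_map measurable_Zf.aemeasurable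

lemma ae_nu {P : (Pt d → ℤ) → Prop} (h : ∀ᵐ z ∂(nu μ), P z) : ∀ᵐ ω ∂μ, P (Zf ω) :=
  ae_of_ae_map measurable_Zf.aemeasurable h

lemma ae_shf {P : (ℕ → Fin (d + 1) × Bool) → Prop} (n : ℕ) (h : ∀ᵐ ω ∂μ, P ω) :
    ∀ᵐ ω ∂μ, P (shf n ω) :=
  (mp_shf hμ n).quasiMeasurePreserving.ae h

lemma p_pos (n : ℕ) (w : Fin n → Fin (d + 1) × Bool) : 0 < p μ n (W n w) := by
  have := hμ.1
  have h1 : μ (pre n ⁻¹' {w}) ≤ μ {ω | lampWalk d ω n = W n w} :=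
    measure_mono (by intro ω h; simp only [mem_preimage, mem_singleton_iff] at h; simp [walk_eq, h])
  rw [cyl_meas hμ] at h1
  refine ENNReal.toReal_pos ?_ (measure_ne_top _ _)
  intro h0
  rw [h0] at h1
  have h2 : ((Fintype.card (Fin (d + 1) × Bool) : ENNReal))⁻¹ ^ n ≠ 0 :=
    pow_ne_zero _ (ENNReal.inv_ne_zero.2 (ENNReal.natCast_ne_top _))
  exact h2 (le_antisymm h1 bot_le)

include hd

lemma split_meas (n : ℕ) (a : Lamp d) {B : Set (Pt d → ℤ)} (hB : MeasurableSet B) :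
    μ ({ω | lampWalk d ω n = a} ∩ Zf ⁻¹' B)
      = μ {ω | lampWalk d ω n = a} * ((nu μ).map (act a)) B := by
  have h := map_restrict_pre hμ n {w | W n w = a}
  have h2 : MeasurableSet (Zf ⁻¹' (act a ⁻¹' B)) := measurable_Zf (measurable_act a hB)
  have h3 := congrArg (fun m => m (Zf ⁻¹' (act a ⁻¹' B))) h
  simp only [Measure.smul_apply, smul_eq_mul] at h3
  rw [Measure.map_apply (measurable_shf n) h2, Measure.restrict_apply (measurable_shf n h2)] at h3
  rw [Measure.map_apply (measurable_act a) hB, nu, Measure.map_apply measurable_Zf (measurable_act a hB)]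
  rw [walk_set n (fun b => b = a), ← h3]
  refine measure_congr ?_
  filter_upwards [good_ae hμ hd] with ω hω
  change (_ ∧ _) = (_ ∧ _)
  simp only [eq_iff_iff]
  rw [and_comm]
  refine and_congr_left ?_
  intro hw
  have hw : W n (pre n ω) = a := hw
  have := hω.equivar n
  rw [walk_eq, hw] at this
  change Zf ω ∈ B ↔ act a (Zf (shf n ω)) ∈ B
  rw [this]

lemma dom {a : Lamp d} (ha : Rch a) : ∃ c : NNReal, (nu μ).map (act a) ≤ c • nu μ := by
  have := hμ.1
  obtain ⟨n, w, rfl⟩ := ha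
  have hp : μ {ω | lampWalk d ω n = W n w} ≠ 0 := by
    intro h
    have := p_pos hμ n w
    unfold p Measure.real at this
    rw [h] at this
    simp at this
  have hp' : μ {ω | lampWalk d ω n = W n w} ≠ ⊤ := measure_ne_top _ _
  refine ⟨((μ {ω | lampWalk d ω n = W n w})⁻¹).toNNReal, ?_⟩
  rw [Measure.le_iff]
  intro B hB
  rw [Measure.smul_apply]
  have h := split_meas hμ hd n (W n w) hB
  have h1 : (nu μ).map (act (W n w)) B = (μ {ω | lampWalk d ω n = W n w})⁻¹ * μ ({ω | lampWalk d ω n = W n w} ∩ Zf ⁻¹' B) := by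
    rw [h, ← mul_assoc, ENNReal.inv_mul_cancel hp hp', one_mul]
  rw [h1, ENNReal.smul_def, ENNReal.coe_toNNReal (ENNReal.inv_ne_top.2 hp), smul_eq_mul]
  gcongr
  rw [nu, Measure.map_apply measurable_Zf hB]
  exact measure_mono inter_subset_right

lemma ac {a : Lamp d} (ha : Rch a) : (nu μ).map (act a) ≪ nu μ := by
  obtain ⟨c, hc⟩ := dom hμ hd ha
  exact (Measure.absolutelyContinuous_of_le hc).trans (Measure.smul_absolutelyContinuous)

lemma De_le {a : Lamp d} (ha : Rch a) : ∃ c : NNReal, ∀ᵐ z ∂(nu μ), De μ a z ≤ c := by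
  have := nu_prob hμ
  obtain ⟨c, hc⟩ := dom hμ hd ha
  refine ⟨c, ?_⟩
  refine ae_le_of_forall_setLIntegral_le_of_sigmaFinite (measurable_De a) ?_
  intro s hs _
  rw [setLIntegral_const]
  refine (Measure.setLIntegral_rnDeriv_le s).trans ?_
  exact hc s

lemma with_De {a : Lamp d} (ha : Rch a) : (nu μ).withDensity (De μ a) = (nu μ).map (act a) := by
  have := nu_prob hμ
  have : IsProbabilityMeasure ((nu μ).map (act a)) :=
    Measure.isProbabilityMeasure_map (measurable_act a).aemeasurable
  exact Measure.withDensity_rnDeriv_eq _ _ (ac hμ hd ha)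

lemma De_mul {a b : Lamp d} (ha : Rch a) (hb : Rch b) :
    ∀ᵐ z ∂(nu μ), De μ (a * b) z = De μ a z * De μ b (act a⁻¹ z) := by
  have := nu_prob hμ
  have hm : Measurable fun z => De μ b (act a⁻¹ z) := (measurable_De b).comp (measurable_act _)
  have h : (nu μ).map (act (a * b)) = (nu μ).withDensity (De μ a * fun z => De μ b (act a⁻¹ z)) := by
    rw [withDensity_mul _ (measurable_De a) hm, with_De hμ hd ha]
    have e : (act (a * b) : (Pt d → ℤ) → _) = act a ∘ act b := funext fun z => act_mul a b z
    rw [e, ← Measure.map_map (measurable_act a) (measurable_act b), ← with_De hμ hd hb]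
    ext s hs
    rw [Measure.map_apply (measurable_act a) hs, withDensity_apply _ hs,
      withDensity_apply _ (measurable_act a hs), setLIntegral_map hs hm (measurable_act a)]
    simp only [act_inv_act]
  have h2 := Measure.rnDeriv_withDensity (nu μ) ((measurable_De (μ := μ) a).mul hm)
  rw [← h] at h2
  exact h2

lemma De_one : ∀ᵐ z ∂(nu μ), De μ (1 : Lamp d) z = 1 := by
  have := nu_prob hμ
  have e : (act (1 : Lamp d) : (Pt d → ℤ) → _) = id := funext fun z => act_one z
  unfold De
  rw [e, Measure.map_id]
  exact Measure.rnDeriv_self (nu μ)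

lemma act_ae {a : Lamp d} (ha : Rch a) {P : (Pt d → ℤ) → Prop} (h : ∀ᵐ z ∂(nu μ), P z) :
    ∀ᵐ z ∂(nu μ), P (act a z) :=
  ae_of_ae_map (measurable_act a).aemeasurable ((ac hμ hd ha).ae_le h)

lemma D_bd {a : Lamp d} (ha : Rch a) : ∃ M : ℝ, 1 ≤ M ∧
    ∀ᵐ z ∂(nu μ), M⁻¹ ≤ D μ a z ∧ D μ a z ≤ M := by
  obtain ⟨c, hc⟩ := De_le hμ hd ha
  obtain ⟨c', hc'⟩ := De_le hμ hd ha.inv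
  refine ⟨max 1 (max c c'), le_max_left _ _, ?_⟩
  have hM : (1:ℝ) ≤ max (1:ℝ) (max (c:ℝ) (c':ℝ)) := le_max_left _ _
  have h3 := De_mul hμ hd ha ha.inv
  rw [mul_inv_cancel] at h3
  filter_upwards [hc, act_ae hμ hd ha.inv hc', h3, De_one hμ hd] with z h1 h2 h3 h4
  have h5 : D μ a z ≤ c := by
    have := ENNReal.toReal_mono ENNReal.coe_ne_top h1
    simpa [D] using this
  have h6 : D μ a⁻¹ (act a⁻¹ z) ≤ c' := by
    have := ENNReal.toReal_mono ENNReal.coe_ne_top h2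
    simpa [D] using this
  rw [h4] at h3
  have h7 : 1 = D μ a z * D μ a⁻¹ (act a⁻¹ z) := by
    have := congrArg ENNReal.toReal h3
    simpa [D] using this
  have h8 := D_nonneg (μ := μ) a z
  constructor
  · rw [inv_le_iff_one_le_mul₀ (by linarith)]
    rw [h7]
    exact mul_le_mul_of_nonneg_left (h6.trans ((le_max_right _ _).trans (le_max_right _ _))) h8
  · exact h5.trans ((le_max_left _ _).trans (le_max_right _ _))

lemma D_bd_n (n : ℕ) : ∃ M : ℝ, 1 ≤ M ∧ ∀ᵐ ω ∂μ, ∀ w : Fin n → Fin (d + 1) × Bool,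
    M⁻¹ ≤ D μ (W n w) (Zf ω) ∧ D μ (W n w) (Zf ω) ≤ M := by
  have h : ∀ w : Fin n → Fin (d + 1) × Bool, ∃ M : ℝ, 1 ≤ M ∧
    ∀ᵐ z ∂(nu μ), M⁻¹ ≤ D μ (W n w) z ∧ D μ (W n w) z ≤ M := fun w => D_bd hμ hd ⟨n, w, rfl⟩
  choose M hM h using h
  have hle : ∀ w, M w ≤ 1 + ∑ w, M w := fun w => by
    have := Finset.single_le_sum (f := M) (fun w _ => zero_le_one.trans (hM w)) (Finset.mem_univ w)
    linarith
  refine ⟨1 + ∑ w, M w, ?_, ?_⟩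
  · have := Finset.sum_nonneg (s := Finset.univ) (f := M) (fun w _ => zero_le_one.trans (hM w))
    linarith
  · rw [ae_all_iff]
    intro w
    filter_upwards [ae_nu hμ (h w)] with ω hω
    exact ⟨(inv_anti₀ (by linarith [hM w]) (hle w)).trans hω.1, hω.2.trans (hle w)⟩

lemma D_coc (k j : ℕ) : ∀ᵐ ω ∂μ, D μ (lampWalk d ω (k + j)) (Zf ω)
    = D μ (lampWalk d ω k) (Zf ω) * D μ (lampWalk d (shf k ω) j) (Zf (shf k ω)) := by
  have h : ∀ᵐ ω ∂μ, ∀ (w : Fin k → Fin (d + 1) × Bool) (w' : Fin j → Fin (d + 1) × Bool),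
      De μ (W k w * W j w') (Zf ω) = De μ (W k w) (Zf ω) * De μ (W j w') (act (W k w)⁻¹ (Zf ω)) := by
    rw [ae_all_iff]; intro w
    rw [ae_all_iff]; intro w'
    exact ae_nu hμ (De_mul hμ hd ⟨k, w, rfl⟩ ⟨j, w', rfl⟩)
  filter_upwards [h, good_ae hμ hd] with ω h hω
  have := h (pre k ω) (pre j (shf k ω))
  rw [← walk_eq, ← walk_eq, ← walk_add] at this
  have e := hω.equivar k
  have e2 : act (lampWalk d ω k)⁻¹ (Zf ω) = Zf (shf k ω) := by
    rw [e, act_inv_act]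
  rw [e2] at this
  have := congrArg ENNReal.toReal this
  rw [ENNReal.toReal_mul] at this
  exact this

lemma R1 (n : ℕ) (w : Fin n → Fin (d + 1) × Bool) {g : (Pt d → ℤ) → ℝ} (hg : Measurable g) :
    ∫ ω in {ω | lampWalk d ω n = W n w}, g (Zf ω) ∂μ
      = p μ n (W n w) * ∫ ω, D μ (W n w) (Zf ω) * g (Zf ω) ∂μ := by
  have := hμ.1
  have := nu_prob hμ
  have : IsProbabilityMeasure ((nu μ).map (act (W n w))) :=
    Measure.isProbabilityMeasure_map (measurable_act _).aemeasurable
  have h1 : ∫ ω in {ω | lampWalk d ω n = W n w}, g (Zf ω) ∂μ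
      = ∫ ω in pre n ⁻¹' {w' | W n w' = W n w}, (fun ω' => g (act (W n w) (Zf ω'))) (shf n ω) ∂μ := by
    refine setIntegral_congr_ae (measurableSet_walk n (fun b => b = W n w)) ?_
    filter_upwards [good_ae hμ hd] with ω hω h
    have h : lampWalk d ω n = W n w := h
    rw [hω.equivar n, h]
  rw [h1, setIntegral_shf hμ n _ (fun ω' => g (act (W n w) (Zf ω'))) (hg.comp ((measurable_act _).comp measurable_Zf)).aestronglyMeasurable]
  rw [← walk_set n (fun b => b = W n w)]
  change p μ n (W n w) * _ = _
  congr 1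
  have h2 := integral_toReal_rnDeriv_mul (f := g) (ac hμ hd ⟨n, w, rfl⟩)
  rw [integral_map (measurable_act _).aemeasurable hg.aestronglyMeasurable] at h2
  change ∫ x, D μ (W n w) x * g x ∂(nu μ) = _ at h2
  have m1 : Measurable fun z => D μ (W n w) z * g z := (measurable_D _).mul hg
  have m2 : Measurable fun z => g (act (W n w) z) := hg.comp (measurable_act _)
  rw [nu, integral_map measurable_Zf.aemeasurable m1.aestronglyMeasurable,
    integral_map measurable_Zf.aemeasurable m2.aestronglyMeasurable] at h2
  exact h2.symm

end
end LL

namespace LL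
open MeasureTheory Set Filter

variable {d : ℕ} {μ : Measure (ℕ → Fin (d + 1) × Bool)}

lemma measurable_walk_fun {β : Type*} [MeasurableSpace β] (n : ℕ)
    (f : Lamp d → (ℕ → Fin (d + 1) × Bool) → β) (hf : ∀ a, Measurable (f a)) :
    Measurable fun ω => f (lampWalk d ω n) ω := by
  have h : Measurable (fun q : (ℕ → Fin (d + 1) × Bool) × (Fin n → Fin (d + 1) × Bool) =>
      f (W n q.2) q.1) := measurable_from_prod_countable_left (fun y => hf (W n y))
  exact h.comp (measurable_id.prodMk (measurable_pre n))

open Classical in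
/-- Elements reachable in exactly `n` steps. -/
noncomputable def SW (d n : ℕ) : Finset (Lamp d) := Finset.univ.image (W n)

lemma mem_SW (n : ℕ) (ω : ℕ → Fin (d + 1) × Bool) : lampWalk d ω n ∈ SW d n := by
  classical
  exact Finset.mem_image.2 ⟨pre n ω, Finset.mem_univ _, rfl⟩

lemma exists_SW {n : ℕ} {a : Lamp d} (h : a ∈ SW d n) : ∃ w, W n w = a := by
  classical
  obtain ⟨w, -, h⟩ := Finset.mem_image.1 h
  exact ⟨w, h⟩

lemma integral_split (n : ℕ) {f : (ℕ → Fin (d + 1) × Bool) → ℝ} (hf : Integrable f μ) :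
    ∫ ω, f ω ∂μ = ∑ a ∈ SW d n, ∫ ω in {ω | lampWalk d ω n = a}, f ω ∂μ := by
  rw [← integral_biUnion_finset _ (fun a _ => measurableSet_walk n (fun b => b = a)) ?_ (fun a _ => hf.integrableOn)]
  · have : (⋃ a ∈ SW d n, {ω : ℕ → Fin (d + 1) × Bool | lampWalk d ω n = a}) = univ := by
      ext ω
      simp [mem_SW]
    rw [this, Measure.restrict_univ]
  · intro a _ b _ hab
    rw [Function.onFun, Set.disjoint_left]
    intro ω h1 h2
    exact hab (h1.symm.trans h2)

lemma hellinger {Ω : Type*} [MeasurableSpace Ω] {P : Measure Ω} [IsProbabilityMeasure P]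
    {r : Ω → ℝ} (hr : Measurable r) {C : ℝ} (h : ∀ᵐ ω ∂P, 0 < r ω ∧ r ω ≤ C)
    (hl : Integrable (fun ω => Real.log (r ω)) P)
    (h1 : ∫ ω, r ω ∂P ≤ 1) {s : ℝ} (hs : 0 < s) (h2 : ∫ ω, - Real.log (r ω) ∂P ≤ s ^ 2) :
    ∫ ω, |1 - r ω| ∂P ≤ 3 * s := by
  have hri : Integrable r P := by
    refine Integrable.of_bound hr.aestronglyMeasurable C ?_
    filter_upwards [h] with ω hω
    rw [Real.norm_eq_abs, abs_of_pos hω.1]; exact hω.2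
  have key : ∀ᵐ ω ∂P, |1 - r ω| ≤ (- Real.log (r ω) + (r ω - 1)) / (2 * s) + s * (1 + r ω) := by
    filter_upwards [h] with ω hω
    have hq := Real.sqrt_pos.2 hω.1
    have hsq := Real.sq_sqrt hω.1.le
    set q := √(r ω)
    have e1 : Real.log (r ω) ≤ 2 * (q - 1) := by
      rw [← hsq, Real.log_pow]
      have := Real.log_le_sub_one_of_pos hq
      push_cast; linarith
    have e2 : |1 - r ω| ≤ (1 - q) ^ 2 / (2 * s) + s * (1 + q) ^ 2 / 2 := by
      rw [← hsq]
      have e3 : (1 - q) ^ 2 / (2 * s) + s * (1 + q) ^ 2 / 2 = ((1 - q) ^ 2 + (s * (1 + q)) ^ 2) / (2 * s) := by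
        field_simp
      rw [e3, le_div_iff₀ (by positivity)]
      rw [show 1 - q ^ 2 = (1 - q) * (1 + q) by ring, abs_mul, abs_of_pos (by linarith : 0 < 1 + q)]
      have := sq_nonneg (|1 - q| - s * (1 + q))
      rw [sub_sq, sq_abs] at this
      linarith
    refine e2.trans (add_le_add ?_ ?_)
    · gcongr
      nlinarith
    · nlinarith [sq_nonneg (1 - q)]
  have i1 : Integrable (fun ω => - Real.log (r ω)) P := hl.neg
  have i2 : Integrable (fun ω => r ω - 1) P := hri.sub (integrable_const _)
  have i3 : Integrable (fun ω => 1 + r ω) P := (integrable_const _).add hri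
  have := integral_mono_ae (((integrable_const 1).sub hri).abs) (((i1.add i2).div_const (2*s)).add (i3.const_mul s)) key
  refine this.trans ?_
  rw [integral_add' ((i1.add i2).div_const (2*s)) (i3.const_mul s), integral_div, integral_const_mul]
  simp only [Pi.add_apply]
  rw [integral_add i1 i2, integral_add (integrable_const _) hri, integral_sub hri (integrable_const _)]
  simp only [integral_const, probReal_univ, smul_eq_mul, mul_one]
  have e : (∫ ω, - Real.log (r ω) ∂P + (∫ ω, r ω ∂P - 1)) / (2 * s) ≤ s := by
    rw [div_le_iff₀ (by positivity)]; nlinarith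
  have e' : s * (1 + ∫ ω, r ω ∂P) ≤ s * 2 := by gcongr; linarith
  linarith

/-- Information functional. -/
noncomputable def Hf (μ : Measure (ℕ → Fin (d + 1) × Bool)) (n : ℕ) (ω : ℕ → Fin (d + 1) × Bool) : ℝ :=
  - Real.log (p μ n (lampWalk d ω n)) - Real.log (D μ (lampWalk d ω n) (Zf ω))

/-- Conditional entropy. -/
noncomputable def Hent (μ : Measure (ℕ → Fin (d + 1) × Bool)) (n : ℕ) : ℝ := ∫ ω, Hf μ n ω ∂μ

lemma measurable_DX (n : ℕ) : Measurable fun ω => D μ (lampWalk d ω n) (Zf ω) :=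
  measurable_walk_fun n (fun a ω => D μ a (Zf ω)) (fun a => (measurable_D a).comp measurable_Zf)

section
variable (hμ : IsUniformBernoulli (Fin (d + 1) × Bool) μ) (hd : 3 ≤ d)
include hμ

lemma p_pos' (n : ℕ) (ω : ℕ → Fin (d + 1) × Bool) : 0 < p μ n (lampWalk d ω n) := p_pos hμ n _

lemma p_le_one (n : ℕ) (a : Lamp d) : p μ n a ≤ 1 := by
  have := hμ.1
  exact measureReal_le_one

lemma p_lower (n : ℕ) : ∃ c : ℝ, 0 < c ∧ ∀ ω, c ≤ p μ n (lampWalk d ω n) := by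
  obtain ⟨w, hw⟩ := Finite.exists_min (fun w : Fin n → Fin (d + 1) × Bool => p μ n (W n w))
  exact ⟨p μ n (W n w), p_pos hμ n w, fun ω => hw (pre n ω)⟩

include hd

lemma Hf_int (n : ℕ) : Integrable (Hf μ n) μ := by
  have := hμ.1
  obtain ⟨c, hc, hcp⟩ := p_lower hμ n
  obtain ⟨M, hM, h⟩ := D_bd_n hμ hd n
  refine Integrable.of_bound (C := - Real.log c + Real.log M) ?_ ?_
  · refine Measurable.aestronglyMeasurable ?_
    exact ((measurable_walk_comp n (fun a => Real.log (p μ n a))).neg).sub (measurable_DX n).log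
  · filter_upwards [h] with ω hω
    have h1 := hω (pre n ω)
    rw [← walk_eq] at h1
    have hM0 : 0 < M := by linarith
    have hD0 : 0 < D μ (lampWalk d ω n) (Zf ω) := lt_of_lt_of_le (inv_pos.2 hM0) h1.1
    have a1 := Real.log_le_log hc (hcp ω)
    have a2 := Real.log_nonpos (p_pos' hμ n ω).le (p_le_one hμ n (lampWalk d ω n))
    have a3 := Real.log_le_log (inv_pos.2 hM0) h1.1
    have a4 := Real.log_le_log hD0 h1.2
    rw [Real.log_inv] at a3
    rw [Real.norm_eq_abs, Hf, abs_le]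
    constructor <;> linarith

lemma gibbs (n : ℕ) (q : Lamp d → (Pt d → ℤ) → ℝ) (hqm : ∀ b, Measurable (q b))
    (hq0 : ∀ b z, 0 ≤ q b z) (hq1 : ∀ z, ∑ b ∈ SW d n, q b z ≤ 1)
    {Q : (ℕ → Fin (d + 1) × Bool) → ℝ} (hQ : Integrable Q μ)
    (h : ∀ᵐ ω ∂μ, 0 < q (lampWalk d ω n) (Zf ω) ∧ - Real.log (q (lampWalk d ω n) (Zf ω)) ≤ Q ω) :
    Hent μ n ≤ ∫ ω, Q ω ∂μ := by
  have := hμ.1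
  obtain ⟨c, hc, hcp⟩ := p_lower hμ n
  obtain ⟨M, hM, hD⟩ := D_bd_n hμ hd n
  have hM0 : 0 < M := by linarith
  have hq1' : ∀ b ∈ SW d n, ∀ z, q b z ≤ 1 := fun b hb z =>
    (Finset.single_le_sum (f := fun b => q b z) (fun b _ => hq0 b z) hb).trans (hq1 z)
  set R : (ℕ → Fin (d + 1) × Bool) → ℝ := fun ω =>
    q (lampWalk d ω n) (Zf ω) / (p μ n (lampWalk d ω n) * D μ (lampWalk d ω n) (Zf ω)) with hR
  have hRm : Measurable R := by
    refine (measurable_walk_fun n (fun b ω => q b (Zf ω)) (fun b => (hqm b).comp measurable_Zf)).div ?_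
    exact (measurable_walk_comp n (p μ n)).mul (measurable_DX n)
  have hDpos : ∀ᵐ ω ∂μ, ∀ w : Fin n → Fin (d + 1) × Bool, 0 < D μ (W n w) (Zf ω) := by
    filter_upwards [hD] with ω hω w
    exact lt_of_lt_of_le (inv_pos.2 hM0) (hω w).1
  have hRi : Integrable R μ := by
    refine Integrable.of_bound (C := 1 / (c * M⁻¹)) hRm.aestronglyMeasurable ?_
    filter_upwards [hD] with ω hω
    have h1 := (hω (pre n ω)).1
    rw [← walk_eq] at h1
    have h2 := hcp ω
    have h3 : 0 < M⁻¹ := inv_pos.2 hM0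
    rw [Real.norm_eq_abs, abs_of_nonneg (div_nonneg (hq0 _ _) (mul_nonneg (p_pos' hμ n ω).le (D_nonneg _ _)))]
    exact div_le_div₀ zero_le_one (hq1' _ (mem_SW n ω) _) (by positivity) (mul_le_mul h2 h1 h3.le (p_pos' hμ n ω).le)
  have hRint : ∫ ω, R ω ∂μ ≤ 1 := by
    rw [integral_split n hRi]
    have e : ∀ b ∈ SW d n, ∫ ω in {ω | lampWalk d ω n = b}, R ω ∂μ = ∫ ω, q b (Zf ω) ∂μ := by
      intro b hb
      obtain ⟨w, rfl⟩ := exists_SW hb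
      have e1 : ∫ ω in {ω | lampWalk d ω n = W n w}, R ω ∂μ
          = ∫ ω in {ω | lampWalk d ω n = W n w}, (fun z => q (W n w) z / (p μ n (W n w) * D μ (W n w) z)) (Zf ω) ∂μ := by
        refine setIntegral_congr_fun (measurableSet_walk n (fun b => b = W n w)) ?_
        intro ω hω
        have hω : lampWalk d ω n = W n w := hω
        simp only [hR, hω]
      have hm : Measurable fun z => q (W n w) z / (p μ n (W n w) * D μ (W n w) z) :=
        (hqm _).div ((measurable_D _).const_mul _)
      rw [e1, R1 hμ hd n w hm, ← integral_const_mul]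
      refine integral_congr_ae ?_
      filter_upwards [hDpos] with ω hω
      have := (hω w).ne'
      have := (p_pos hμ n w).ne'
      field_simp
    rw [Finset.sum_congr rfl e, ← integral_finset_sum]
    · have : ∫ ω, ∑ b ∈ SW d n, q b (Zf ω) ∂μ ≤ ∫ ω, (1:ℝ) ∂μ := by
        refine integral_mono_of_nonneg ?_ (integrable_const _) ?_
        · exact Eventually.of_forall fun ω => Finset.sum_nonneg fun b _ => hq0 b _
        · exact Eventually.of_forall fun ω => hq1 _
      simpa using this
    · intro b hb
      refine Integrable.of_bound (C := 1) ((hqm b).comp measurable_Zf).aestronglyMeasurable ?_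
      refine Eventually.of_forall fun ω => ?_
      rw [Real.norm_eq_abs, abs_of_nonneg (hq0 _ _)]
      exact hq1' b hb _
  have key : ∀ᵐ ω ∂μ, Hf μ n ω ≤ Q ω + (R ω - 1) := by
    filter_upwards [h, hDpos] with ω hω hD
    have hD' : 0 < D μ (lampWalk d ω n) (Zf ω) := hD (pre n ω)
    have hp := p_pos' hμ n ω
    have h1 := Real.log_le_sub_one_of_pos (div_pos hω.1 (mul_pos hp hD'))
    rw [Real.log_div hω.1.ne' (mul_pos hp hD').ne', Real.log_mul hp.ne' hD'.ne'] at h1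
    have h2 := hω.2
    unfold Hf
    simp only [hR]
    linarith
  have := integral_mono_ae (Hf_int hμ hd n) (hQ.add (hRi.sub (integrable_const 1))) key
  rw [integral_add' hQ (hRi.sub (integrable_const 1)), integral_sub' hRi (integrable_const 1)] at this
  simp only [integral_const, probReal_univ, smul_eq_mul, mul_one] at this
  unfold Hent
  linarith

end
end LL

namespace LL
open MeasureTheory Set Filter

variable {d : ℕ} {μ : Measure (ℕ → Fin (d + 1) × Bool)}

section
variable (hμ : IsUniformBernoulli (Fin (d + 1) × Bool) μ) (hd : 3 ≤ d)
include hμ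

lemma joint (k j : ℕ) (a b : Lamp d) :
    μ.real ({ω | lampWalk d ω k = a} ∩ {ω | lampWalk d ω (k + j) = b})
      = p μ k a * p μ j (a⁻¹ * b) := by
  have := hμ.1
  have e : ({ω | lampWalk d ω k = a} ∩ {ω | lampWalk d ω (k + j) = b})
      = shf k ⁻¹' {ω | lampWalk d ω j = a⁻¹ * b} ∩ pre k ⁻¹' {w | W k w = a} := by
    ext ω
    simp only [mem_inter_iff, mem_setOf_eq, mem_preimage, ← walk_eq, walk_add]
    constructor
    · rintro ⟨rfl, rfl⟩; simp
    · rintro ⟨h, rfl⟩; simp [h]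
  have hm := measurableSet_walk (d := d) j (fun c => c = a⁻¹ * b)
  have h := congrArg (fun m => m {ω | lampWalk d ω j = a⁻¹ * b}) (map_restrict_pre hμ k {w | W k w = a})
  simp only [Measure.smul_apply, smul_eq_mul] at h
  rw [Measure.map_apply (measurable_shf k) hm, Measure.restrict_apply (measurable_shf k hm), ← e] at h
  unfold p
  rw [Measure.real, h, ENNReal.toReal_mul]
  rfl

include hd

/-- The likelihood ratio. -/
lemma K1 (k j : ℕ) (a : Lamp d) (ha : a ∈ SW d k) (f : Lamp d → (ℕ → Fin (d + 1) × Bool) → ℝ)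
    (hf : ∀ b, Measurable (f b)) (hf0 : ∀ b ω, 0 ≤ f b ω) (hf1 : ∀ b ω, f b ω ≤ 1)
    {r : (ℕ → Fin (d + 1) × Bool) → ℝ}
    (hr : r = fun ω => D μ (lampWalk d ω k) (Zf ω) *
      (p μ (k + j) (lampWalk d ω (k + j)) / p μ j (lampWalk d (shf k ω) j)))
    (hri : Integrable r μ) :
    ∫ ω in {ω | lampWalk d ω k = a}, r ω * f (lampWalk d ω (k + j)) (shf (k + j) ω) ∂μ
      ≤ p μ k a * ∫ ω, D μ a (Zf ω) * f (lampWalk d ω (k + j)) (shf (k + j) ω) ∂μ := by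
  have := hμ.1
  have hfm : Measurable fun ω => f (lampWalk d ω (k + j)) (shf (k + j) ω) :=
    measurable_walk_fun (k + j) (fun b ω => f b (shf (k + j) ω)) (fun b => (hf b).comp (measurable_shf _))
  have hfn : ∀ ω, ‖f (lampWalk d ω (k + j)) (shf (k + j) ω)‖ ≤ 1 := fun ω => by
    rw [Real.norm_eq_abs, abs_of_nonneg (hf0 _ _)]; exact hf1 _ _
  have hA : MeasurableSet {ω | lampWalk d ω k = a} := measurableSet_walk k (fun b => b = a)
  have hB : ∀ b, MeasurableSet {ω | lampWalk d ω (k + j) = b} :=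
    fun b => measurableSet_walk (k + j) (fun c => c = b)
  have i1 : Integrable (fun ω => r ω * f (lampWalk d ω (k + j)) (shf (k + j) ω)) μ :=
    hri.mul_bdd (c := 1) hfm.aestronglyMeasurable (Eventually.of_forall hfn)
  obtain ⟨w, rfl⟩ := exists_SW ha
  obtain ⟨M, hM, hD⟩ := D_bd_n hμ hd k
  have i0 : Integrable (fun ω => D μ (W k w) (Zf ω)) μ := by
    refine Integrable.of_bound (C := M) ((measurable_D _).comp measurable_Zf).aestronglyMeasurable ?_
    filter_upwards [hD] with ω hω
    rw [Real.norm_eq_abs, abs_of_nonneg (D_nonneg _ _)]; exact (hω w).2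
  have i2 : Integrable (fun ω => D μ (W k w) (Zf ω) * f (lampWalk d ω (k + j)) (shf (k + j) ω)) μ :=
    i0.mul_bdd (c := 1) hfm.aestronglyMeasurable (Eventually.of_forall hfn)
  rw [← integral_indicator hA, integral_split (k + j) (i1.indicator hA), integral_split (k + j) i2,
    Finset.mul_sum]
  refine Finset.sum_le_sum fun b hb => ?_
  set G : (ℕ → Fin (d + 1) × Bool) → ℝ := fun ω => D μ (W k w) (act b (Zf ω)) * f b ω with hG
  have hGm : Measurable G := ((measurable_D _).comp ((measurable_act b).comp measurable_Zf)).mul (hf b)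
  have hG0 : 0 ≤ ∫ ω, G ω ∂μ := integral_nonneg fun ω => mul_nonneg (D_nonneg _ _) (hf0 _ _)
  -- right
  have er : ∫ ω in {ω | lampWalk d ω (k + j) = b},
      D μ (W k w) (Zf ω) * f (lampWalk d ω (k + j)) (shf (k + j) ω) ∂μ
      = p μ (k + j) b * ∫ ω, G ω ∂μ := by
    have h := setIntegral_shf hμ (k + j) {w | W (k + j) w = b} G hGm.aestronglyMeasurable
    rw [← walk_set (k + j) (fun c => c = b)] at h
    refine Eq.trans ?_ h
    refine setIntegral_congr_ae (hB b) ?_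
    filter_upwards [good_ae hμ hd] with ω hω h
    have h : lampWalk d ω (k + j) = b := h
    rw [hω.equivar (k + j), h]
  have el : ∫ ω in {ω | lampWalk d ω (k + j) = b},
      {ω | lampWalk d ω k = W k w}.indicator (fun ω => r ω * f (lampWalk d ω (k + j)) (shf (k + j) ω)) ω ∂μ
      = (p μ (k + j) b / p μ j ((W k w)⁻¹ * b)) * ((p μ k (W k w) * p μ j ((W k w)⁻¹ * b)) * ∫ ω, G ω ∂μ) := by
    rw [setIntegral_indicator hA, inter_comm, ← joint hμ k j (W k w) b]
    have h := setIntegral_shf hμ (k + j)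
      {v | W k (fun i => v (Fin.castAdd j i)) = W k w ∧ W (k + j) v = b} G hGm.aestronglyMeasurable
    have es : ({ω | lampWalk d ω k = W k w} ∩ {ω | lampWalk d ω (k + j) = b})
      = pre (k + j) ⁻¹' {v | W k (fun i => v (Fin.castAdd j i)) = W k w ∧ W (k + j) v = b} := rfl
    rw [← es] at h
    rw [← h, ← integral_const_mul]
    refine setIntegral_congr_ae (hA.inter (hB b)) ?_
    filter_upwards [good_ae hμ hd] with ω hω h
    have h1 : lampWalk d ω k = W k w := h.1
    have h2 : lampWalk d ω (k + j) = b := h.2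
    have h3 : lampWalk d (shf k ω) j = (W k w)⁻¹ * b := by
      rw [← h2, walk_add, h1]; simp
    simp only [hr, hG, h1, h2, h3]
    rw [hω.equivar (k + j), h2]
    ring
  rw [er, el]
  by_cases h0 : p μ j ((W k w)⁻¹ * b) = 0
  · rw [h0]
    simp only [div_zero, mul_zero, zero_mul]
    exact mul_nonneg measureReal_nonneg (mul_nonneg measureReal_nonneg hG0)
  · apply le_of_eq
    field_simp

lemma K (k j : ℕ) (a : Lamp d) (ha : a ∈ SW d k) (f : Lamp d → (ℕ → Fin (d + 1) × Bool) → ℝ)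
    (hf : ∀ b, Measurable (f b)) (hf0 : ∀ b ω, 0 ≤ f b ω) (hf1 : ∀ b ω, f b ω ≤ 1)
    {s : ℝ} (hs : 0 < s) (hH : Hent μ (k + j) - Hent μ j ≤ s ^ 2) :
    |∫ ω in {ω | lampWalk d ω k = a}, f (lampWalk d ω (k + j)) (shf (k + j) ω) ∂μ
      - p μ k a * ∫ ω, D μ a (Zf ω) * f (lampWalk d ω (k + j)) (shf (k + j) ω) ∂μ| ≤ 3 * s := by
  have := hμ.1
  set r : (ℕ → Fin (d + 1) × Bool) → ℝ := fun ω => D μ (lampWalk d ω k) (Zf ω) *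
      (p μ (k + j) (lampWalk d ω (k + j)) / p μ j (lampWalk d (shf k ω) j)) with hr
  obtain ⟨c, hc, hcp⟩ := p_lower hμ j
  obtain ⟨M, hM, hD⟩ := D_bd_n hμ hd k
  obtain ⟨M', hM', hD'⟩ := D_bd_n hμ hd j
  have hM0 : 0 < M := by linarith
  have hM0' : 0 < M' := by linarith
  have hrm : Measurable r := by
    refine (measurable_DX k).mul ((measurable_walk_comp (k + j) (p μ (k + j))).div ?_)
    exact (measurable_walk_comp j (p μ j)).comp (measurable_shf k)
  have hDpos : ∀ᵐ ω ∂μ, 0 < D μ (lampWalk d ω k) (Zf ω) := by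
    filter_upwards [hD] with ω hω
    exact lt_of_lt_of_le (inv_pos.2 hM0) (hω (pre k ω)).1
  have hDpos' : ∀ᵐ ω ∂μ, 0 < D μ (lampWalk d ω j) (Zf ω) := by
    filter_upwards [hD'] with ω hω
    exact lt_of_lt_of_le (inv_pos.2 hM0') (hω (pre j ω)).1
  have hrb : ∀ᵐ ω ∂μ, 0 < r ω ∧ r ω ≤ M * (1 / c) := by
    filter_upwards [hD, hDpos] with ω hω hp
    refine ⟨mul_pos hp (div_pos (p_pos' hμ _ _) (p_pos' hμ _ _)), ?_⟩
    exact mul_le_mul (hω (pre k ω)).2 (div_le_div₀ zero_le_one (p_le_one hμ _ _) hc (hcp _))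
      (div_nonneg (p_pos' hμ _ _).le (p_pos' hμ _ _).le) hM0.le
  have hri : Integrable r μ := by
    refine Integrable.of_bound hrm.aestronglyMeasurable (M * (1 / c)) ?_
    filter_upwards [hrb] with ω hω
    rw [Real.norm_eq_abs, abs_of_pos hω.1]; exact hω.2
  have hlog : ∀ᵐ ω ∂μ, - Real.log (r ω) = Hf μ (k + j) ω - Hf μ j (shf k ω) := by
    filter_upwards [hDpos, ae_shf hμ k hDpos', D_coc hμ hd k j] with ω h1 h2 h3
    have q1 := p_pos' hμ (k + j) ω
    have q2 := p_pos' hμ j (shf k ω)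
    simp only [hr, Hf]
    rw [h3, Real.log_mul h1.ne' (div_pos q1 q2).ne', Real.log_div q1.ne' q2.ne', Real.log_mul h1.ne' h2.ne']
    ring
  have hHs : Integrable (fun ω => Hf μ j (shf k ω)) μ := (mp_shf hμ k).integrable_comp_of_integrable (Hf_int hμ hd j)
  have hli : Integrable (fun ω => - Real.log (r ω)) μ :=
    ((Hf_int hμ hd (k + j)).sub hHs).congr (by filter_upwards [hlog] with ω h; exact h.symm)
  have hE : ∫ ω, - Real.log (r ω) ∂μ = Hent μ (k + j) - Hent μ j := by
    rw [integral_congr_ae hlog, integral_sub (Hf_int hμ hd (k + j)) hHs]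
    have e : ∫ ω, Hf μ j (shf k ω) ∂μ = Hent μ j := by
      have h := integral_map (μ := μ) (f := Hf μ j) (measurable_shf k).aemeasurable
        (by rw [(mp_shf hμ k).map_eq]; exact (Hf_int hμ hd j).aestronglyMeasurable)
      rw [(mp_shf hμ k).map_eq] at h
      exact h.symm
    rw [e]; rfl
  have hD1 : ∀ a ∈ SW d k, p μ k a * ∫ ω, D μ a (Zf ω) ∂μ = p μ k a := by
    intro a ha
    obtain ⟨w, rfl⟩ := exists_SW ha
    have h := R1 hμ hd k w (g := fun _ => 1) measurable_const
    simp only [mul_one] at h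
    rw [← h]
    simp [p]
  have hr1 : ∫ ω, r ω ∂μ ≤ 1 := by
    rw [integral_split k hri]
    have h : ∀ a ∈ SW d k, ∫ ω in {ω | lampWalk d ω k = a}, r ω ∂μ ≤ ∫ ω in {ω | lampWalk d ω k = a}, (1:ℝ) ∂μ := by
      intro a ha
      have h := K1 hμ hd k j a ha (fun _ _ => 1) (fun _ => measurable_const) (fun _ _ => zero_le_one)
        (fun _ _ => le_rfl) hr hri
      simp only [mul_one] at h
      rw [hD1 a ha] at h
      simpa [p] using h
    refine (Finset.sum_le_sum h).trans ?_
    rw [← integral_split k (integrable_const 1)]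
    simp
  have hT := hellinger hrm hrb (by simpa using hli.neg) hr1 hs (hE.le.trans hH)
  have hA : MeasurableSet {ω | lampWalk d ω k = a} := measurableSet_walk k (fun b => b = a)
  have iD : Integrable (fun ω => D μ a (Zf ω)) μ := by
    obtain ⟨w, rfl⟩ := exists_SW ha
    refine Integrable.of_bound (C := M) ((measurable_D _).comp measurable_Zf).aestronglyMeasurable ?_
    filter_upwards [hD] with ω hω
    rw [Real.norm_eq_abs, abs_of_nonneg (D_nonneg _ _)]; exact (hω w).2
  -- one-sided bound
  have one : ∀ g : Lamp d → (ℕ → Fin (d + 1) × Bool) → ℝ, (∀ b, Measurable (g b)) → (∀ b ω, 0 ≤ g b ω) →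
      (∀ b ω, g b ω ≤ 1) →
      ∫ ω in {ω | lampWalk d ω k = a}, g (lampWalk d ω (k + j)) (shf (k + j) ω) ∂μ
      - p μ k a * ∫ ω, D μ a (Zf ω) * g (lampWalk d ω (k + j)) (shf (k + j) ω) ∂μ ≤ 3 * s := by
    intro g hg hg0 hg1
    have hgm : Measurable fun ω => g (lampWalk d ω (k + j)) (shf (k + j) ω) :=
      measurable_walk_fun (k + j) (fun b ω => g b (shf (k + j) ω)) (fun b => (hg b).comp (measurable_shf _))
    have hgn : ∀ ω, ‖g (lampWalk d ω (k + j)) (shf (k + j) ω)‖ ≤ 1 := fun ω => by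
      rw [Real.norm_eq_abs, abs_of_nonneg (hg0 _ _)]; exact hg1 _ _
    have i1 : Integrable (fun ω => g (lampWalk d ω (k + j)) (shf (k + j) ω)) μ :=
      Integrable.of_bound hgm.aestronglyMeasurable 1 (Eventually.of_forall hgn)
    have i2 : Integrable (fun ω => r ω * g (lampWalk d ω (k + j)) (shf (k + j) ω)) μ :=
      hri.mul_bdd (c := 1) hgm.aestronglyMeasurable (Eventually.of_forall hgn)
    have h1 := K1 hμ hd k j a ha g hg hg0 hg1 hr hri
    have i3 : Integrable (fun ω => |1 - r ω|) μ := ((integrable_const 1).sub hri).abs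
    have h2 : ∫ ω in {ω | lampWalk d ω k = a}, g (lampWalk d ω (k + j)) (shf (k + j) ω) ∂μ
        - ∫ ω in {ω | lampWalk d ω k = a}, r ω * g (lampWalk d ω (k + j)) (shf (k + j) ω) ∂μ
        ≤ ∫ ω, |1 - r ω| ∂μ := by
      rw [← integral_sub i1.integrableOn i2.integrableOn]
      refine le_trans ?_ (setIntegral_le_integral (s := {ω | lampWalk d ω k = a}) i3
        (Eventually.of_forall fun ω => abs_nonneg _))
      refine integral_mono (i1.sub i2).integrableOn i3.integrableOn ?_
      intro ω
      have e : g (lampWalk d ω (k + j)) (shf (k + j) ω) - r ω * g (lampWalk d ω (k + j)) (shf (k + j) ω)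
        = (1 - r ω) * g (lampWalk d ω (k + j)) (shf (k + j) ω) := by ring
      simp only [e]
      refine (le_abs_self _).trans ?_
      rw [abs_mul]
      exact mul_le_of_le_one_right (abs_nonneg _) (hgn ω)
    linarith
  have o1 := one f hf hf0 hf1
  have o2 := one (fun b ω => 1 - f b ω) (fun b => measurable_const.sub (hf b))
    (fun b ω => sub_nonneg.2 (hf1 b ω)) (fun b ω => sub_le_self _ (hf0 b ω))
  have hfm : Measurable fun ω => f (lampWalk d ω (k + j)) (shf (k + j) ω) :=
    measurable_walk_fun (k + j) (fun b ω => f b (shf (k + j) ω)) (fun b => (hf b).comp (measurable_shf _))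
  have hfn : ∀ ω, ‖f (lampWalk d ω (k + j)) (shf (k + j) ω)‖ ≤ 1 := fun ω => by
    rw [Real.norm_eq_abs, abs_of_nonneg (hf0 _ _)]; exact hf1 _ _
  have j1 : Integrable (fun ω => f (lampWalk d ω (k + j)) (shf (k + j) ω)) μ :=
    Integrable.of_bound hfm.aestronglyMeasurable 1 (Eventually.of_forall hfn)
  have j2 : Integrable (fun ω => D μ a (Zf ω) * f (lampWalk d ω (k + j)) (shf (k + j) ω)) μ :=
    iD.mul_bdd (c := 1) hfm.aestronglyMeasurable (Eventually.of_forall hfn)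
  simp only [mul_sub, mul_one] at o2
  rw [integral_sub (integrable_const 1) j1.integrableOn, integral_sub iD j2, mul_sub, hD1 a ha] at o2
  have e1 : ∫ ω in {ω | lampWalk d ω k = a}, (1:ℝ) ∂μ = p μ k a := by simp [p]
  rw [e1] at o2
  rw [abs_le]
  constructor <;> linarith

end
end LL

namespace LL
open MeasureTheory Set Filter

variable {d : ℕ} {μ : Measure (ℕ → Fin (d + 1) × Bool)}

lemma site_sum {lam : ℝ} (h0 : 0 < lam) (h1 : lam ≤ 1 / 2) (T : Finset ℤ) (z : ℤ) :
    ∑ x ∈ T, (1 + 4 * lam)⁻¹ * lam ^ (x - z).natAbs ≤ 1 := by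
  have hl : lam < 1 := by linarith
  have hs : HasSum (fun u : ℤ => lam ^ u.natAbs) ((1 - lam)⁻¹ + lam * (1 - lam)⁻¹) := by
    refine HasSum.of_nat_of_neg_add_one ?_ ?_
    · simpa using hasSum_geometric_of_lt_one h0.le hl
    · have := (hasSum_geometric_of_lt_one h0.le hl).mul_left lam
      refine this.congr_fun ?_
      intro n
      rw [show (-((n:ℤ) + 1)).natAbs = n + 1 by omega, pow_succ, mul_comm]
  have h2 : ∑ x ∈ T, lam ^ (x - z).natAbs ≤ (1 - lam)⁻¹ + lam * (1 - lam)⁻¹ := by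
    have := hs.summable.sum_le_tsum (T.map ⟨fun x => x - z, sub_left_injective⟩) (fun _ _ => by positivity)
    rw [hs.tsum_eq, Finset.sum_map] at this
    exact this
  rw [← Finset.mul_sum, inv_mul_le_iff₀ (by positivity), mul_one]
  refine h2.trans ?_
  have h3 : 0 < 1 - lam := by linarith
  rw [← one_add_mul, ← div_eq_mul_inv, div_le_iff₀ h3]
  nlinarith

lemma code_sum {lam : ℝ} (h0 : 0 < lam) (h1 : lam ≤ 1 / 2) (N : Finset (Pt d)) (e : Pt d)
    (z : Pt d → ℤ) (B : Finset (Lamp d))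
    (hB : ∀ b ∈ B, b.right.toAdd = e ∧ ∀ v, v ∉ N → b.left.toAdd v = 0) :
    ∑ b ∈ B, ∏ v ∈ N, ((1 + 4 * lam)⁻¹ * lam ^ (b.left.toAdd v - z v).natAbs) ≤ 1 := by
  classical
  set T : N → Finset ℤ := fun v => B.image (fun b => b.left.toAdd v.1)
  have e1 : ∑ b ∈ B, ∏ v ∈ N, ((1 + 4 * lam)⁻¹ * lam ^ (b.left.toAdd v - z v).natAbs)
      = ∑ g ∈ B.image (fun b => fun v : N => b.left.toAdd v.1),
        ∏ v : N, ((1 + 4 * lam)⁻¹ * lam ^ (g v - z v).natAbs) := by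
    rw [Finset.sum_image]
    · refine Finset.sum_congr rfl fun b _ => ?_
      rw [← Finset.prod_coe_sort N]
    · intro b hb b' hb' h
      obtain ⟨r1, s1⟩ := hB b hb
      obtain ⟨r2, s2⟩ := hB b' hb'
      refine SemidirectProduct.ext ?_ ?_
      · refine Multiplicative.toAdd.injective ?_
        ext v
        by_cases hv : v ∈ N
        · exact congrFun h ⟨v, hv⟩
        · rw [s1 v hv, s2 v hv]
      · exact Multiplicative.toAdd.injective (r1.trans r2.symm)
  rw [e1]
  calc _ ≤ ∑ g ∈ Fintype.piFinset T, ∏ v : N, ((1 + 4 * lam)⁻¹ * lam ^ (g v - z v).natAbs) := by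
        refine Finset.sum_le_sum_of_subset_of_nonneg ?_ ?_
        · intro g hg
          obtain ⟨b, hb, rfl⟩ := Finset.mem_image.1 hg
          rw [Fintype.mem_piFinset]
          intro v
          exact Finset.mem_image.2 ⟨b, hb, rfl⟩
        · intro g _ _
          positivity
    _ = ∏ v : N, ∑ x ∈ T v, ((1 + 4 * lam)⁻¹ * lam ^ (x - z v).natAbs) := by
        rw [Finset.prod_univ_sum]
    _ ≤ 1 := Finset.prod_le_one (fun v _ => Finset.sum_nonneg fun _ _ => by positivity)
        (fun v _ => site_sum h0 h1 _ _)

end LL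

namespace LL
open MeasureTheory Set Filter

variable {d : ℕ} {μ : Measure (ℕ → Fin (d + 1) × Bool)}

lemma sum_image_le' {α β : Type*} [DecidableEq β] (s : Finset α) (f : α → β) (g : β → ℝ) (hg : ∀ b, 0 ≤ g b) :
    ∑ v ∈ s.image f, g v ≤ ∑ x ∈ s, g (f x) := by
  rw [Finset.sum_comp g f]
  refine Finset.sum_le_sum fun v hv => ?_
  obtain ⟨x, hx, rfl⟩ := Finset.mem_image.1 hv
  rw [nsmul_eq_mul]
  refine le_mul_of_one_le_left (hg _) ?_
  have : 0 < (Finset.filter (fun a => f a = f x) s).card :=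
    Finset.card_pos.2 ⟨x, Finset.mem_filter.2 ⟨hx, rfl⟩⟩
  exact_mod_cast this

/-- Boxes. -/
noncomputable def box (d m : ℕ) : Finset (Pt d) := Fintype.piFinset (fun _ : Fin d => Finset.Icc (-(m:ℤ)) m)

lemma card_box (d m : ℕ) : (box d m).card = (2 * m + 1) ^ d := by
  rw [box, Fintype.card_piFinset]
  simp only [Int.card_Icc, Finset.prod_const, Finset.card_univ, Fintype.card_fin]
  congr 1
  omega

lemma mem_box {m : ℕ} {x : Pt d} (h : ∀ i, |x i| ≤ m) : x ∈ box d m := by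
  rw [box, Fintype.mem_piFinset]
  intro i
  exact Finset.mem_Icc.2 (abs_le.1 (h i))

/-- Coarse positions of a code. -/
def cpos {l : ℕ} (y : Fin l → Pt d) (j : ℕ) : Pt d :=
  ∑ i ∈ Finset.range j, if h : i < l then y ⟨i, h⟩ else 0

/-- Neighbourhood of a coarse path. -/
noncomputable def nbh (m : ℕ) {l : ℕ} (y : Fin l → Pt d) : Finset (Pt d) :=
  (Finset.range l ×ˢ box d m).image (fun q => cpos y q.1 + q.2)

/-- The code of a trajectory. -/
noncomputable def code (m l : ℕ) (ω : ℕ → Fin (d + 1) × Bool) : Fin l → Pt d :=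
  fun i => pos (m * (i + 1)) ω - pos (m * i) ω

lemma cpos_code (m l : ℕ) (ω : ℕ → Fin (d + 1) × Bool) (j : ℕ) (hj : j ≤ l) :
    cpos (code m l ω) j = pos (m * j) ω := by
  have : cpos (code m l ω) j = ∑ i ∈ Finset.range j, (pos (m * (i + 1)) ω - pos (m * i) ω) := by
    refine Finset.sum_congr rfl fun i hi => ?_
    rw [dif_pos (by have := Finset.mem_range.1 hi; omega)]
    rfl
  rw [this, Finset.sum_range_sub (fun i => pos (m * i) ω)]
  simp [pos_zero]

lemma code_mem (m l : ℕ) (ω : ℕ → Fin (d + 1) × Bool) :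
    code m l ω ∈ Fintype.piFinset (fun _ : Fin l => box d m) := by
  rw [Fintype.mem_piFinset]
  intro i
  refine mem_box fun c => ?_
  have : code m l ω i = pos m (shf (m * i) ω) := by
    rw [code, mul_add, mul_one, pos_add]; simp
  rw [this]
  exact pos_le m _ c

lemma visited_mem (m l : ℕ) (hm : 0 < m) (ω : ℕ → Fin (d + 1) × Bool) (t : ℕ) (ht : t < m * l) :
    pos t ω ∈ nbh m (code m l ω) := by
  refine Finset.mem_image.2 ⟨(t / m, pos (t % m) (shf (m * (t / m)) ω)), ?_, ?_⟩
  · rw [Finset.mem_product]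
    refine ⟨Finset.mem_range.2 (Nat.div_lt_of_lt_mul ht), mem_box fun c => ?_⟩
    refine (pos_le _ _ c).trans ?_
    exact_mod_cast (Nat.mod_lt t hm).le
  · have : t / m < l := Nat.div_lt_of_lt_mul ht
    simp only
    rw [cpos_code m l ω _ this.le, ← pos_add, Nat.div_add_mod]

/-- The total discrepancy between the current and the final configuration. -/
noncomputable def Err (m l : ℕ) (ω : ℕ → Fin (d + 1) × Bool) : ℝ :=
  ∑ q ∈ Finset.range l ×ˢ box d m,
    |((Zf ω (pos (m * q.1) ω + q.2) - lampCfg d ω (m * l) (pos (m * q.1) ω + q.2) : ℤ) : ℝ)|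

/-- Expected number of late visits. -/
noncomputable def Tl (μ : Measure (ℕ → Fin (d + 1) × Bool)) (m k : ℕ) : ENNReal :=
  ∑ x ∈ box d m, ∑' i, μ {ω | pos (k + i) ω = x}

lemma measurable_Err (m l : ℕ) : Measurable (Err m l : (ℕ → Fin (d + 1) × Bool) → ℝ) := by
  refine Finset.measurable_sum _ fun q _ => ?_
  refine measurable_walk_fun (m * q.1) (fun a ω => |((Zf ω (a.right.toAdd + q.2) - lampCfg d ω (m * l) (a.right.toAdd + q.2) : ℤ) : ℝ)|) ?_
  intro a
  have h1 : Measurable fun ω : ℕ → Fin (d + 1) × Bool => Zf ω (a.right.toAdd + q.2) :=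
    (measurable_pi_apply _).comp measurable_Zf
  have h2 : Measurable fun ω : ℕ → Fin (d + 1) × Bool => lampCfg d ω (m * l) (a.right.toAdd + q.2) :=
    measurable_walk_comp (m * l) (fun b => b.left.toAdd (a.right.toAdd + q.2))
  have h3 : Measurable fun u : ℤ => |(u : ℝ)| := measurable_of_countable _
  exact h3.comp (h1.sub h2)

section
variable (hμ : IsUniformBernoulli (Fin (d + 1) × Bool) μ) (hd : 3 ≤ d)
include hμ hd

lemma Tl_tendsto (m : ℕ) : Tendsto (Tl μ m) atTop (nhds 0) := by
  have : Tendsto (Tl μ m) atTop (nhds (∑ x ∈ box d m, 0)) := by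
    refine tendsto_finset_sum _ fun x _ => ?_
    have := ENNReal.tendsto_sum_nat_add _ (green hμ hd x)
    refine this.congr fun k => ?_
    simp only [add_comm]
  simpa using this

lemma Tl_ne_top (m k : ℕ) : Tl μ m k ≠ ⊤ := by
  refine (ENNReal.sum_lt_top.2 fun x _ => ?_).ne
  refine lt_of_le_of_lt ?_ (lt_top_iff_ne_top.2 (green hμ hd x))
  exact ENNReal.tsum_comp_le_tsum_of_injective (f := fun i => k + i) (fun a b h => by simpa using h) (fun t => μ {ω | pos t ω = x})

lemma Err_lint (m l : ℕ) : ∫⁻ ω, ENNReal.ofReal (Err m l ω) ∂μ ≤ ∑ i ∈ Finset.range l, Tl μ m (m * (i + 1)) := by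
  have h1 : ∀ᵐ ω ∂μ, ENNReal.ofReal (Err m l ω) ≤ ∑ q ∈ Finset.range l ×ˢ box d m,
      ∑' i, if pos (m * (l - q.1) + i) (shf (m * q.1) ω) = q.2 then (1 : ENNReal) else 0 := by
    filter_upwards [good_ae hμ hd] with ω hω
    rw [Err, ENNReal.ofReal_sum_of_nonneg (fun _ _ => abs_nonneg _)]
    refine Finset.sum_le_sum fun q hq => ?_
    refine (hω.diff (m * l) _).trans (le_of_eq ?_)
    congr 1; ext i
    have hq1 := Finset.mem_range.1 (Finset.mem_product.1 hq).1
    have : m * l + i = m * q.1 + (m * (l - q.1) + i) := by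
      rw [← add_assoc, ← mul_add]; congr 2; omega
    rw [this, pos_add]
    simp only [add_right_inj]
  refine (lintegral_mono_ae h1).trans (le_of_eq ?_)
  have hms : ∀ k x, MeasurableSet {ω : ℕ → Fin (d + 1) × Bool | pos k ω = x} :=
    fun k x => measurableSet_pos k (fun y => y = x)
  have hmi : ∀ (k s : ℕ) (x : Pt d), Measurable fun ω : ℕ → Fin (d + 1) × Bool =>
      if pos k (shf s ω) = x then (1 : ENNReal) else 0 := fun k s x =>
    Measurable.ite (measurable_shf s (hms k x)) measurable_const measurable_const
  rw [lintegral_finset_sum _ (fun q _ => Measurable.ennreal_tsum fun i => hmi _ _ _), Finset.sum_product,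
    ← Finset.sum_range_reflect]
  refine Finset.sum_congr rfl fun j hj => ?_
  have hj := Finset.mem_range.1 hj
  refine Finset.sum_congr rfl fun x _ => ?_
  rw [lintegral_tsum (fun i => (hmi _ _ _).aemeasurable)]
  congr 1; ext i
  simp only
  have e : ∀ ω : ℕ → Fin (d + 1) × Bool, (if pos (m * (l - (l - 1 - j)) + i) (shf (m * (l - 1 - j)) ω) = x then (1 : ENNReal) else 0)
    = (shf (m * (l - 1 - j)) ⁻¹' {ω | pos (m * (l - (l - 1 - j)) + i) ω = x}).indicator 1 ω := by
    intro ω; simp [Set.indicator_apply]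
  simp only [e]
  rw [lintegral_indicator_one (measurable_shf _ (hms _ _)), (mp_shf hμ _).measure_preimage (hms _ _).nullMeasurableSet]
  rw [show l - (l - 1 - j) = j + 1 by omega]

lemma Err_int (m l : ℕ) : Integrable (Err m l) μ ∧
    ∫ ω, Err m l ω ∂μ ≤ ∑ i ∈ Finset.range l, (Tl μ m (m * (i + 1))).toReal := by
  have hnn : ∀ ω : ℕ → Fin (d + 1) × Bool, 0 ≤ Err m l ω := fun ω => Finset.sum_nonneg fun _ _ => abs_nonneg _
  have hfin : ∑ i ∈ Finset.range l, Tl μ m (m * (i + 1)) ≠ ⊤ :=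
    (ENNReal.sum_lt_top.2 fun i _ => lt_top_iff_ne_top.2 (Tl_ne_top hμ hd _ _)).ne
  have h := Err_lint hμ hd m l
  constructor
  · refine ⟨(measurable_Err m l).aestronglyMeasurable, ?_⟩
    rw [hasFiniteIntegral_iff_ofReal (Eventually.of_forall hnn)]
    exact lt_of_le_of_lt h (lt_top_iff_ne_top.2 hfin)
  · rw [integral_eq_lintegral_of_nonneg_ae (Eventually.of_forall hnn) (measurable_Err m l).aestronglyMeasurable,
      ← ENNReal.toReal_sum (fun i _ => Tl_ne_top hμ hd _ _)]
    exact ENNReal.toReal_mono hfin h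

end
end LL

namespace LL
open MeasureTheory Set Filter

variable {d : ℕ} {μ : Measure (ℕ → Fin (d + 1) × Bool)}

open Classical in
/-- One summand of the comparison kernel. -/
noncomputable def qk (m : ℕ) (lam : ℝ) {l : ℕ} (y : Fin l → Pt d) (b : Lamp d) (z : Pt d → ℤ) : ℝ :=
  if b.right.toAdd = cpos y l ∧ ∀ v, v ∉ nbh m y → b.left.toAdd v = 0 then
    ∏ v ∈ nbh m y, ((1 + 4 * lam)⁻¹ * lam ^ (b.left.toAdd v - z v).natAbs) else 0

lemma qk_nonneg (m : ℕ) {lam : ℝ} (h0 : 0 < lam) {l : ℕ} (y : Fin l → Pt d) (b : Lamp d) (z : Pt d → ℤ) :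
    0 ≤ qk m lam y b z := by
  unfold qk
  split_ifs
  · positivity
  · exact le_rfl

lemma qk_sum (m : ℕ) {lam : ℝ} (h0 : 0 < lam) (h1 : lam ≤ 1 / 2) {l : ℕ} (y : Fin l → Pt d)
    (B : Finset (Lamp d)) (z : Pt d → ℤ) : ∑ b ∈ B, qk m lam y b z ≤ 1 := by
  classical
  unfold qk
  rw [← Finset.sum_filter]
  exact code_sum h0 h1 _ (cpos y l) z _ (fun b hb => (Finset.mem_filter.1 hb).2)

lemma measurable_qk (m : ℕ) (lam : ℝ) {l : ℕ} (y : Fin l → Pt d) (b : Lamp d) : Measurable (qk m lam y b) := by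
  unfold qk
  split_ifs
  · refine Finset.measurable_prod _ fun v _ => ?_
    have h3 : Measurable fun u : ℤ => (1 + 4 * lam)⁻¹ * lam ^ (b.left.toAdd v - u).natAbs := measurable_of_countable _
    exact h3.comp (measurable_pi_apply v)
  · exact measurable_const

section
variable (hμ : IsUniformBernoulli (Fin (d + 1) × Bool) μ) (hd : 3 ≤ d)
include hμ hd

lemma Hent_le (m l : ℕ) (hm : 0 < m) {lam : ℝ} (h0 : 0 < lam) (h1 : lam ≤ 1 / 2) :
    Hent μ (m * l) ≤ l * (d * Real.log (2 * m + 1)) + l * (2 * m + 1) ^ d * (4 * lam)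
      + (- Real.log lam) * ∑ i ∈ Finset.range l, (Tl μ m (m * (i + 1))).toReal := by
  classical
  have := hμ.1
  set Y := Fintype.piFinset (fun _ : Fin l => box d m) with hY
  have hYc : Y.card = ((2 * m + 1) ^ d) ^ l := by
    rw [hY, Fintype.card_piFinset]
    simp [card_box]
  have hYpos : (0:ℝ) < Y.card := by rw [hYc]; positivity
  have hll : 0 ≤ - Real.log lam := by
    have := Real.log_nonpos h0.le (by linarith); linarith
  obtain ⟨hEi, hEb⟩ := Err_int hμ hd m l
  have hQi : Integrable (fun ω => (l * (d * Real.log (2 * m + 1)) + l * (2 * m + 1) ^ d * (4 * lam))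
      + (- Real.log lam) * Err m l ω) μ := (integrable_const _).add (hEi.const_mul _)
  have h := gibbs hμ hd (m * l) (fun b z => (Y.card : ℝ)⁻¹ * ∑ y ∈ Y, qk m lam y b z)
    (fun b => (Finset.measurable_sum _ fun y _ => measurable_qk m lam y b).const_mul _)
    (fun b z => mul_nonneg (by positivity) (Finset.sum_nonneg fun y _ => qk_nonneg m h0 y b z))
    ?_ hQi ?_
  · refine h.trans ?_
    rw [integral_add (integrable_const _) (hEi.const_mul _), integral_const_mul]
    simp only [integral_const, probReal_univ, smul_eq_mul, one_mul]
    gcongr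
  · intro z
    rw [← Finset.mul_sum, Finset.sum_comm, inv_mul_le_iff₀ hYpos, mul_one]
    refine (Finset.sum_le_sum fun y _ => qk_sum m h0 h1 y _ z).trans ?_
    simp
  · refine Eventually.of_forall fun ω => ?_
    have hk : 0 < 1 + 4 * lam := by positivity
    have e1 : qk m lam (code m l ω) (lampWalk d ω (m * l)) (Zf ω)
        = ∏ v ∈ nbh m (code m l ω), ((1 + 4 * lam)⁻¹ * lam ^ (lampCfg d ω (m * l) v - Zf ω v).natAbs) := by
      unfold qk
      rw [if_pos]
      · rfl
      · refine ⟨(cpos_code m l ω l le_rfl).symm, fun v hv => ?_⟩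
        by_contra hne
        obtain ⟨t, ht, rfl⟩ := cfg_ne_zero ω (m * l) v hne
        exact hv (visited_mem m l hm ω t ht)
    set P := ∏ v ∈ nbh m (code m l ω), ((1 + 4 * lam)⁻¹ * lam ^ (lampCfg d ω (m * l) v - Zf ω v).natAbs) with hP
    have hPpos : 0 < P := by positivity
    have hge : (Y.card : ℝ)⁻¹ * P ≤ (Y.card : ℝ)⁻¹ * ∑ y ∈ Y, qk m lam y (lampWalk d ω (m * l)) (Zf ω) := by
      gcongr
      rw [← e1]
      exact Finset.single_le_sum (f := fun y => qk m lam y (lampWalk d ω (m * l)) (Zf ω))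
        (fun y _ => qk_nonneg m h0 y _ _) (code_mem m l ω)
    have hpos : 0 < (Y.card : ℝ)⁻¹ * P := by positivity
    refine ⟨hpos.trans_le hge, ?_⟩
    have hlog := Real.log_le_log hpos hge
    rw [Real.log_mul (inv_pos.2 hYpos).ne' hPpos.ne', Real.log_inv] at hlog
    have hYl : Real.log Y.card = l * (d * Real.log (2 * m + 1)) := by
      rw [hYc]; push_cast; rw [Real.log_pow, Real.log_pow]
    have hPl : Real.log P = ∑ v ∈ nbh m (code m l ω),
        (- Real.log (1 + 4 * lam) + ((lampCfg d ω (m * l) v - Zf ω v).natAbs : ℝ) * Real.log lam) := by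
      rw [hP, Real.log_prod (fun v _ => by positivity)]
      refine Finset.sum_congr rfl fun v _ => ?_
      rw [Real.log_mul (by positivity) (by positivity), Real.log_inv, Real.log_pow]
    rw [Finset.sum_add_distrib, Finset.sum_const, nsmul_eq_mul, ← Finset.sum_mul] at hPl
    have hcard : ((nbh m (code m l ω)).card : ℝ) ≤ l * (2 * m + 1) ^ d := by
      have : (nbh m (code m l ω)).card ≤ l * (2 * m + 1) ^ d := by
        refine Finset.card_image_le.trans ?_
        rw [Finset.card_product, card_box, Finset.card_range]
      exact_mod_cast this
    have hl4 : Real.log (1 + 4 * lam) ≤ 4 * lam := by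
      have := Real.log_le_sub_one_of_pos hk; linarith
    have hl0 : 0 ≤ Real.log (1 + 4 * lam) := Real.log_nonneg (by linarith)
    have hE : ∑ v ∈ nbh m (code m l ω), ((lampCfg d ω (m * l) v - Zf ω v).natAbs : ℝ) ≤ Err m l ω := by
      refine (sum_image_le' _ _ _ (fun v => by positivity)).trans (le_of_eq ?_)
      refine Finset.sum_congr rfl fun q hq => ?_
      have hq1 := Finset.mem_range.1 (Finset.mem_product.1 hq).1
      rw [cpos_code m l ω _ hq1.le, Nat.cast_natAbs, Int.cast_abs, ← abs_neg]
      push_cast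
      ring_nf
    have hb1 : ((nbh m (code m l ω)).card : ℝ) * Real.log (1 + 4 * lam) ≤ l * (2 * m + 1) ^ d * (4 * lam) :=
      mul_le_mul hcard hl4 hl0 (by positivity)
    have hb2 := mul_le_mul_of_nonneg_left hE hll
    rw [hYl, hPl] at hlog
    nlinarith

lemma Hent_small {ε : ℝ} (hε : 0 < ε) : ∃ m : ℕ, 0 < m ∧ ∀ᶠ l : ℕ in atTop, Hent μ (m * l) ≤ ε * (m * l) := by
  have t1 : Tendsto (fun m : ℕ => (d : ℝ) * Real.log (2 * m + 1) / m) atTop (nhds 0) := by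
    have a := (Real.isLittleO_log_id_atTop.tendsto_div_nhds_zero)
    have b : Tendsto (fun m : ℕ => (2 * (m:ℝ) + 1)) atTop atTop :=
      tendsto_atTop_add_const_right _ _ (tendsto_natCast_atTop_atTop.const_mul_atTop (by norm_num))
    have c := (a.comp b).const_mul (3 * (d:ℝ))
    rw [mul_zero] at c
    refine squeeze_zero' (Eventually.of_forall fun m => ?_) ?_ c
    · have : 0 ≤ Real.log (2 * (m:ℝ) + 1) := Real.log_nonneg (by linarith [Nat.cast_nonneg (α := ℝ) m])
      positivity
    · filter_upwards [eventually_ge_atTop 1] with m hm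
      have hm' : (1:ℝ) ≤ m := by exact_mod_cast hm
      have : 0 ≤ Real.log (2 * (m:ℝ) + 1) := Real.log_nonneg (by linarith)
      simp only [Function.comp, id]
      rw [← mul_div_assoc, div_le_div_iff₀ (by positivity) (by positivity)]
      have h2 : 0 ≤ (d:ℝ) * Real.log (2 * m + 1) := by positivity
      nlinarith
  obtain ⟨m, hm1, hm2⟩ := ((t1.eventually (gt_mem_nhds (show 0 < ε / 3 by positivity))).and (eventually_ge_atTop 1)).exists
  have hm0 : (0:ℝ) < m := by exact_mod_cast hm2
  refine ⟨m, hm2, ?_⟩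
  rw [div_lt_iff₀ hm0] at hm1
  set V : ℝ := (2 * (m:ℝ) + 1) ^ d with hV
  have hV0 : 0 < V := by positivity
  set lam : ℝ := min (1 / 2) (ε / 3 * m / (4 * V)) with hlam
  have hl0 : 0 < lam := lt_min (by norm_num) (by positivity)
  have hl1 : lam ≤ 1 / 2 := min_le_left _ _
  have hl2 : V * (4 * lam) ≤ ε / 3 * m := by
    have : lam ≤ ε / 3 * m / (4 * V) := min_le_right _ _
    rw [le_div_iff₀ (by positivity)] at this
    linarith
  have hll : 0 ≤ - Real.log lam := by
    have := Real.log_nonpos hl0.le (by linarith); linarith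
  have t2 : Tendsto (fun i : ℕ => (Tl μ m (m * (i + 1))).toReal) atTop (nhds 0) := by
    have a := (ENNReal.tendsto_toReal ENNReal.zero_ne_top).comp (Tl_tendsto hμ hd m)
    have b : Tendsto (fun i : ℕ => m * (i + 1)) atTop atTop :=
      tendsto_atTop_mono (fun i => (Nat.le_succ i).trans (Nat.le_mul_of_pos_left _ hm2)) tendsto_id
    have c := a.comp b
    rw [ENNReal.toReal_zero] at c
    exact c
  have t3 := (t2.cesaro).const_mul (- Real.log lam)
  rw [mul_zero] at t3
  filter_upwards [t3.eventually (gt_mem_nhds (show 0 < ε / 3 * m by positivity)), eventually_ge_atTop 1] with l hl hl1'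
  have hlp : (0:ℝ) < l := by exact_mod_cast hl1'
  refine (Hent_le hμ hd m l hm2 hl0 hl1).trans ?_
  have c1 : (l:ℝ) * (d * Real.log (2 * m + 1)) ≤ l * (ε / 3 * m) := by gcongr
  have c2 : (l:ℝ) * V * (4 * lam) ≤ l * (ε / 3 * m) := by rw [mul_assoc]; gcongr
  have c3 : (- Real.log lam) * ∑ i ∈ Finset.range l, (Tl μ m (m * (i + 1))).toReal ≤ l * (ε / 3 * m) := by
    have := mul_le_mul_of_nonneg_left hl.le hlp.le
    refine le_trans (le_of_eq ?_) this
    field_simp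
  calc _ ≤ l * (ε / 3 * m) + l * (ε / 3 * m) + l * (ε / 3 * m) := add_le_add (add_le_add c1 c2) c3
    _ = ε * (m * l) := by ring

lemma Hent_incr (k : ℕ) (hk : 0 < k) {ε : ℝ} (hε : 0 < ε) : ∃ j, Hent μ (k + j) - Hent μ j < ε := by
  by_contra! hcon
  have h1 : ∀ i : ℕ, ε * i + Hent μ 0 ≤ Hent μ (k * i) := by
    intro i
    induction i with
    | zero => simp
    | succ i ih =>
      have := hcon (k * i)
      rw [show k * (i + 1) = k + k * i by ring]
      push_cast
      linarith
  have hk0 : (0:ℝ) < k := by exact_mod_cast hk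
  obtain ⟨m, hm, h⟩ := Hent_small hμ hd (show 0 < ε / (2 * k) by positivity)
  have hm0 : (0:ℝ) < m := by exact_mod_cast hm
  have b : Tendsto (fun t : ℕ => k * t) atTop atTop :=
    tendsto_atTop_mono (fun i => Nat.le_mul_of_pos_left _ hk) tendsto_id
  have c : Tendsto (fun t : ℕ => ε / 2 * m * (t:ℝ)) atTop atTop :=
    tendsto_natCast_atTop_atTop.const_mul_atTop (by positivity)
  obtain ⟨t, ht1, ht2⟩ := ((b.eventually h).and (c.eventually (eventually_gt_atTop (- Hent μ 0)))).exists
  have h2 := h1 (m * t)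
  rw [show k * (m * t) = m * (k * t) by ring] at h2
  have e : ε / (2 * k) * (m * ((k * t : ℕ) : ℝ)) = ε / 2 * m * t := by
    push_cast; field_simp
  rw [e] at ht1
  push_cast at h2
  nlinarith

end
end LL

namespace LL
open MeasureTheory Set Filter

variable {d : ℕ} {μ : Measure (ℕ → Fin (d + 1) × Bool)}

lemma tail_meas {F : (ℕ → Fin (d + 1) × Bool) → ℝ} (hF : @Measurable _ _ (lampTail d) _ F) : Measurable F := by
  refine hF.mono ?_ le_rfl
  refine (iInf_le _ 0).trans (iSup_le fun n => ?_)
  rintro _ ⟨s, -, rfl⟩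
  exact measurableSet_walk (0 + n) (fun a => a ∈ s)

lemma fac {F : (ℕ → Fin (d + 1) × Bool) → ℝ} (hF : @Measurable _ _ (lampTail d) _ F)
    (h0 : ∀ ω, 0 ≤ F ω) (h1 : ∀ ω, F ω ≤ 1) (N : ℕ) :
    ∃ f : Lamp d → (ℕ → Fin (d + 1) × Bool) → ℝ, (∀ b, Measurable (f b)) ∧ (∀ b ω, 0 ≤ f b ω) ∧
      (∀ b ω, f b ω ≤ 1) ∧ ∀ ω, F ω = f (lampWalk d ω N) (shf N ω) := by
  letI : MeasurableSpace (Lamp d) := ⊤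
  have hF2 : @Measurable _ _ (MeasurableSpace.comap
      (fun (ω : ℕ → Fin (d + 1) × Bool) (n : ℕ) => lampWalk d ω (N + n)) MeasurableSpace.pi) _ F := by
    refine hF.mono ?_ le_rfl
    refine (iInf_le _ N).trans ?_
    rw [MeasurableSpace.pi, MeasurableSpace.comap_iSup]
    refine iSup_mono fun n => ?_
    rw [MeasurableSpace.comap_comp]
    rfl
  obtain ⟨Ψ, hΨ, hFΨ⟩ := hF2.exists_eq_measurable_comp
  refine ⟨fun b ω => max 0 (min 1 (Ψ (fun i => b * lampWalk d ω i))), ?_, ?_, ?_, ?_⟩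
  · intro b
    refine measurable_const.max (measurable_const.min (hΨ.comp ?_))
    exact measurable_pi_lambda _ fun i => measurable_walk_comp i (fun a => b * a)
  · intro b ω; exact le_max_left _ _
  · intro b ω; exact max_le zero_le_one (min_le_left _ _)
  · intro ω
    have : F ω = Ψ (fun i => lampWalk d ω N * lampWalk d (shf N ω) i) := by
      rw [hFΨ]
      simp only [Function.comp, walk_add]
    simp only
    rw [← this, min_eq_right (h1 ω), max_eq_right (h0 ω)]

section
variable (hμ : IsUniformBernoulli (Fin (d + 1) × Bool) μ) (hd : 3 ≤ d)
include hμ hd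

lemma main1 {F : (ℕ → Fin (d + 1) × Bool) → ℝ} (hF : @Measurable _ _ (lampTail d) _ F)
    (h0 : ∀ ω, 0 ≤ F ω) (h1 : ∀ ω, F ω ≤ 1) (k : ℕ) (a : Lamp d) (ha : a ∈ SW d k) :
    ∫ ω in {ω | lampWalk d ω k = a}, F ω ∂μ = p μ k a * ∫ ω, D μ a (Zf ω) * F ω ∂μ := by
  have key : ∀ s : ℝ, 0 < s →
      |∫ ω in {ω | lampWalk d ω k = a}, F ω ∂μ - p μ k a * ∫ ω, D μ a (Zf ω) * F ω ∂μ| ≤ 3 * s := by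
    intro s hs
    have hj : ∃ j, Hent μ (k + j) - Hent μ j < s ^ 2 := by
      rcases Nat.eq_zero_or_pos k with rfl | hk
      · exact ⟨0, by simpa using by positivity⟩
      · exact Hent_incr hμ hd k hk (by positivity)
    obtain ⟨j, hj⟩ := hj
    obtain ⟨f, hf, hf0, hf1, hFf⟩ := fac hF h0 h1 (k + j)
    have := K hμ hd k j a ha f hf hf0 hf1 hs hj.le
    simp only [← hFf] at this
    exact this
  have h2 : |∫ ω in {ω | lampWalk d ω k = a}, F ω ∂μ - p μ k a * ∫ ω, D μ a (Zf ω) * F ω ∂μ| ≤ 0 := by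
    refine le_of_forall_pos_le_add fun ε hε => ?_
    have := key (ε / 3) (by positivity)
    linarith
  exact sub_eq_zero.1 (abs_eq_zero.1 (le_antisymm h2 (abs_nonneg _)))

lemma condG {F : (ℕ → Fin (d + 1) × Bool) → ℝ} (hFm : Measurable F)
    (h0 : ∀ ω, 0 ≤ F ω) (hFi : Integrable F μ) :
    ∃ G : (Pt d → ℤ) → ℝ, Measurable G ∧ Integrable (fun ω => G (Zf ω)) μ ∧ (∀ᵐ ω ∂μ, 0 ≤ G (Zf ω)) ∧
      ∀ k (w : Fin k → Fin (d + 1) × Bool),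
        ∫ ω, D μ (W k w) (Zf ω) * F ω ∂μ = ∫ ω, D μ (W k w) (Zf ω) * G (Zf ω) ∂μ := by
  have := hμ.1
  have hDm : ∀ k (w : Fin k → Fin (d + 1) × Bool), Measurable fun ω => D μ (W k w) (Zf ω) :=
    fun k w => (measurable_D _).comp measurable_Zf
  have hDF : ∀ k (w : Fin k → Fin (d + 1) × Bool), Integrable (fun ω => D μ (W k w) (Zf ω) * F ω) μ := by
    intro k w
    obtain ⟨M, hM, hD⟩ := D_bd_n hμ hd k
    refine hFi.bdd_mul (c := M) (hDm k w).aestronglyMeasurable ?_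
    filter_upwards [hD] with ω hω
    rw [Real.norm_eq_abs, abs_of_nonneg (D_nonneg _ _)]; exact (hω w).2
  set m0 : MeasurableSpace (ℕ → Fin (d + 1) × Bool) := MeasurableSpace.comap Zf MeasurableSpace.pi with hm0
  have hm : m0 ≤ MeasurableSpace.pi := measurable_Zf.comap_le
  obtain ⟨G, hG, hFG⟩ := (stronglyMeasurable_condExp (m := m0) (μ := μ) (f := F)).measurable.exists_eq_measurable_comp
  have hGi : Integrable (fun ω => G (Zf ω)) μ := by
    have := integrable_condExp (m := m0) (μ := μ) (f := F)
    rw [hFG] at this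
    exact this
  have hG0 : ∀ᵐ ω ∂μ, 0 ≤ G (Zf ω) := by
    have := condExp_nonneg (m := m0) (μ := μ) (f := F) (Eventually.of_forall h0)
    rw [hFG] at this
    exact this
  refine ⟨G, hG, hGi, hG0, fun k w => ?_⟩
  have hDm0 : StronglyMeasurable[m0] (fun ω => D μ (W k w) (Zf ω)) :=
    ((measurable_D (W k w)).comp (comap_measurable Zf)).stronglyMeasurable
  have h2 := condExp_mul_of_stronglyMeasurable_left hDm0 (hDF k w) hFi
  have h3 := integral_condExp hm (μ := μ) (f := fun ω => D μ (W k w) (Zf ω) * F ω)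
  rw [← h3]
  refine integral_congr_ae ?_
  refine h2.trans ?_
  rw [hFG]
  rfl

lemma main2 {F : (ℕ → Fin (d + 1) × Bool) → ℝ} (hF : @Measurable _ _ (lampTail d) _ F)
    (h0 : ∀ ω, 0 ≤ F ω) (h1 : ∀ ω, F ω ≤ 1) :
    ∃ G : (Pt d → ℤ) → ℝ, Measurable G ∧ ∀ᵐ ω ∂μ, F ω = G (Zf ω) := by
  have := hμ.1
  have hFm := tail_meas hF
  have hFi : Integrable F μ := by
    refine Integrable.of_bound hFm.aestronglyMeasurable 1 (Eventually.of_forall fun ω => ?_)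
    rw [Real.norm_eq_abs, abs_of_nonneg (h0 ω)]; exact h1 ω
  obtain ⟨G, hG, hGi, hG0, hDG⟩ := condG hμ hd hFm h0 hFi
  refine ⟨G, hG, ?_⟩
  have s1 : ∀ k (w : Fin k → Fin (d + 1) × Bool), ∫ ω in {ω | lampWalk d ω k = W k w}, F ω ∂μ
      = ∫ ω in {ω | lampWalk d ω k = W k w}, G (Zf ω) ∂μ := by
    intro k w
    have ha : W k w ∈ SW d k := by
      classical
      exact Finset.mem_image.2 ⟨w, Finset.mem_univ _, rfl⟩
    rw [main1 hμ hd hF h0 h1 k _ ha, R1 hμ hd k w hG]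
    congr 1
    exact hDG k w
  have s2 : ∀ k (w : Fin k → Fin (d + 1) × Bool), ∫ ω in pre k ⁻¹' {w}, F ω ∂μ
      = ∫ ω in pre k ⁻¹' {w}, G (Zf ω) ∂μ := by
    intro k w
    obtain ⟨f, hf, hf0, hf1, hFf⟩ := fac hF h0 h1 k
    have hgm : Measurable fun ω => G (act (W k w) (Zf ω)) := hG.comp ((measurable_act _).comp measurable_Zf)
    have eF : ∀ T : Set (Fin k → Fin (d + 1) × Bool), (∀ v ∈ T, W k v = W k w) →
        ∫ ω in pre k ⁻¹' T, F ω ∂μ = μ.real (pre k ⁻¹' T) * ∫ ω, f (W k w) ω ∂μ := by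
      intro T hT
      rw [← setIntegral_shf hμ k T _ (hf _).aestronglyMeasurable]
      refine setIntegral_congr_fun (measurableSet_pre k T) ?_
      intro ω hω
      simp only
      rw [hFf ω, walk_eq, hT _ hω]
    have eG : ∀ T : Set (Fin k → Fin (d + 1) × Bool), (∀ v ∈ T, W k v = W k w) →
        ∫ ω in pre k ⁻¹' T, G (Zf ω) ∂μ = μ.real (pre k ⁻¹' T) * ∫ ω, G (act (W k w) (Zf ω)) ∂μ := by
      intro T hT
      rw [← setIntegral_shf hμ k T (fun ω => G (act (W k w) (Zf ω))) hgm.aestronglyMeasurable]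
      refine setIntegral_congr_ae (measurableSet_pre k T) ?_
      filter_upwards [good_ae hμ hd] with ω hg hω
      rw [hg.equivar k, walk_eq, hT _ hω]
    have h := s1 k w
    rw [walk_set k (fun b => b = W k w), eF {v | W k v = W k w} (fun v hv => hv), eG {v | W k v = W k w} (fun v hv => hv)] at h
    have hp : μ.real (pre k ⁻¹' {v | W k v = W k w}) ≠ 0 := by
      have := (p_pos hμ k w).ne'
      rw [p, walk_set k (fun b => b = W k w)] at this
      exact this
    have h := mul_left_cancel₀ hp h
    rw [eF {w} (by rintro v rfl; rfl), eG {w} (by rintro v rfl; rfl), h]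
  have s3 : μ.withDensity (fun ω => ENNReal.ofReal (F ω)) = μ.withDensity (fun ω => ENNReal.ofReal (G (Zf ω))) := by
    have : IsFiniteMeasure (μ.withDensity (fun ω => ENNReal.ofReal (F ω))) :=
      isFiniteMeasure_withDensity_ofReal hFi.2
    refine ext_cyl _ _ fun k w => ?_
    rw [withDensity_apply _ (measurableSet_pre k _), withDensity_apply _ (measurableSet_pre k _),
      ← ofReal_integral_eq_lintegral_ofReal hFi.integrableOn (Eventually.of_forall h0),
      ← ofReal_integral_eq_lintegral_ofReal hGi.integrableOn (ae_restrict_of_ae hG0), s2]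
  have s4 := (withDensity_eq_iff hFm.ennreal_ofReal.aemeasurable
    (hG.comp measurable_Zf).ennreal_ofReal.aemeasurable ?_).1 s3
  · filter_upwards [s4, hG0] with ω h4 hg
    exact (ENNReal.ofReal_eq_ofReal_iff (h0 ω) hg).1 h4
  · have := hFi.2
    rw [hasFiniteIntegral_iff_ofReal (Eventually.of_forall h0)] at this
    exact this.ne

lemma main3 (F : (ℕ → Fin (d + 1) × Bool) → ℝ) (hFb : ∃ C : ℝ, ∀ ω, |F ω| ≤ C)
    (hF : @Measurable _ _ (lampTail d) _ F) :
    ∃ G : (Pt d → ℤ) → ℝ, Measurable G ∧ ∀ᵐ ω ∂μ, F ω = G (Zf ω) := by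
  obtain ⟨C, hC⟩ := hFb
  set B := max C 1
  have hB : 0 < B := lt_of_lt_of_le one_pos (le_max_right _ _)
  have hFB : ∀ ω, |F ω| ≤ B := fun ω => (hC ω).trans (le_max_left _ _)
  have hm : Measurable fun x : ℝ => (x + B) / (2 * B) := by fun_prop
  obtain ⟨G, hG, h⟩ := main2 hμ hd (F := fun ω => (F ω + B) / (2 * B))
    (@Measurable.comp _ _ _ (lampTail d) _ _ _ _ hm hF)
    (fun ω => div_nonneg (by linarith [(abs_le.1 (hFB ω)).1]) (by positivity))
    (fun ω => by rw [div_le_one (by positivity)]; linarith [(abs_le.1 (hFB ω)).2])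
  refine ⟨fun z => 2 * B * G z - B, (hG.const_mul _).sub_const _, ?_⟩
  filter_upwards [h] with ω hω
  rw [← hω]
  field_simp
  ring

end
end LL


/-- For `d ≥ 3`, every bounded tail-measurable function of the random
walk on the lamplighter group `ℤ^d ≀ ℤ` coincides almost everywhere with a measurable
function of the final lamp configuration `Φ_∞(ω)`; i.e. the final configuration generates
the Poisson boundary. -/
theorem lamplighter_tail_functions_factor_through_final_configuration
    (d : ℕ) (hd : 3 ≤ d)
    (μ : MeasureTheory.Measure (ℕ → Fin (d + 1) × Bool))
    (hμ : IsUniformBernoulli (Fin (d + 1) × Bool) μ)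
    (F : (ℕ → Fin (d + 1) × Bool) → ℝ)
    (hFb : ∃ C : ℝ, ∀ ω, |F ω| ≤ C)
    (hFm : @Measurable _ _ (lampTail d) _ F) :
    ∃ G : (Pt d → ℤ) → ℝ, Measurable G ∧
      ∀ᵐ ω ∂μ, F ω = G (fun v => lampFinal d ω v) := by
  exact LL.main3 hμ hd F hFb hFm
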